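/- Let q > 1. There exist a full density subset 𝒩₁ ⊆ 𝒩, a constant C > 0, and a function ε : 𝒩₁ → ℝ with ε(m) → 0 as m → ∞ (m ∈ 𝒩₁), such that for every m ∈ 𝒩₁ one has Σ_{n∈𝒩, n≠m} r₂(n)·|m − n|^{−2q} ≤ C·(log m)^{−q + 1/2 + ε(m)}. -/

import Mathlib

open Filter Topology

noncomputable section

/-- The set of natural numbers expressible as a sum of two squares. -/
def SOS : Set ℕ := {n | ∃ x y : ℤ, (n : ℤ) = x ^ 2 + y ^ 2}

/-- `r₂(n)`, the number of representations of `n` as a sum of two squares. -/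
def r2 (n : ℕ) : ℕ := Nat.card {p : ℤ × ℤ // p.1 ^ 2 + p.2 ^ 2 = (n : ℤ)}

/-- A subset `S ⊆ 𝒩` has full density in `𝒩` if
`#{m ∈ S : m ≤ x} / #{m ∈ 𝒩 : m ≤ x} → 1` as `x → ∞`. -/
def FullDensityIn (S : Set ℕ) : Prop :=
  S ⊆ SOS ∧ Tendsto (fun x : ℕ =>
    (Nat.card {m : ℕ // m ∈ S ∧ m ≤ x} : ℝ) / (Nat.card {m : ℕ // m ∈ SOS ∧ m ≤ x} : ℝ))
    atTop (𝓝 1)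

section Mertens

open Finset ArithmeticFunction

/-- The nontrivial Dirichlet character modulo `4`, as a real function on `ℕ`. -/
def chiFour (n : ℕ) : ℝ := if n % 4 = 1 then 1 else if n % 4 = 3 then -1 else 0

lemma chiFour_mul (m n : ℕ) : chiFour (m * n) = chiFour m * chiFour n := by
  have h4 : m % 4 < 4 := Nat.mod_lt _ (by norm_num)
  have h4' : n % 4 < 4 := Nat.mod_lt _ (by norm_num)
  unfold chiFour
  rw [Nat.mul_mod]
  generalize m % 4 = a at *
  generalize n % 4 = b at *
  interval_cases a <;> interval_cases b <;> norm_num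

lemma abs_chiFour_le_one (n : ℕ) : |chiFour n| ≤ 1 := by
  unfold chiFour; split_ifs <;> simp

lemma sum_chiFour (n : ℕ) :
    ∑ k ∈ Ioc 0 n, chiFour k = if n % 4 = 1 ∨ n % 4 = 2 then 1 else 0 := by
  induction n with
  | zero => simp
  | succ n ih =>
    rw [sum_Ioc_succ_top (by lia), ih]
    have h4 : n % 4 < 4 := Nat.mod_lt _ (by norm_num)
    unfold chiFour
    rw [Nat.add_mod]
    generalize n % 4 = a at *
    interval_cases a <;> norm_num

lemma abs_sum_chiFour_sub_le (a b : ℕ) :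
    |∑ k ∈ Ioc 0 b, chiFour k - ∑ k ∈ Ioc 0 a, chiFour k| ≤ 1 := by
  rw [sum_chiFour, sum_chiFour]; split_ifs <;> simp

/-- Dirichlet's test for `chiFour`: summation against a nonnegative decreasing weight. -/
lemma abs_sum_chiFour_mul_le (f : ℕ → ℝ) (a : ℕ) (hf0 : ∀ n, a < n → 0 ≤ f n)
    (hf : ∀ n, a < n → f (n + 1) ≤ f n) {b : ℕ} (hab : a ≤ b) :
    |∑ k ∈ Ioc a b, chiFour k * f k| ≤ f (a + 1) := by
  rcases hab.eq_or_lt with rfl | hab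
  · simpa using hf0 (a + 1) (by lia)
  have key : ∀ b, a + 1 ≤ b → |∑ k ∈ Ioc a b, chiFour k * f k -
      (∑ k ∈ Ioc 0 b, chiFour k - ∑ k ∈ Ioc 0 a, chiFour k) * f b| ≤ f (a + 1) - f b := by
    intro b hb
    induction b, hb using Nat.le_induction with
    | base => rw [sum_Ioc_succ_top (Nat.zero_le a), sum_Ioc_succ_top le_rfl]; simp
    | succ b hb ih =>
      rw [sum_Ioc_succ_top (by lia), sum_Ioc_succ_top (by lia)]
      have h1 := abs_sum_chiFour_sub_le a b
      have h2 := hf b (by lia)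
      set S := ∑ k ∈ Ioc 0 b, chiFour k
      set S' := ∑ k ∈ Ioc 0 a, chiFour k
      set T := ∑ k ∈ Ioc a b, chiFour k * f k
      have : T + chiFour (b + 1) * f (b + 1) - (S + chiFour (b + 1) - S') * f (b + 1)
          = (T - (S - S') * f b) + (S - S') * (f b - f (b + 1)) := by ring
      rw [this]
      have h3 : |(S - S') * (f b - f (b + 1))| ≤ f b - f (b + 1) := by
        rw [abs_mul, abs_of_nonneg (sub_nonneg.2 h2)]
        exact mul_le_of_le_one_left (sub_nonneg.2 h2) h1
      have h4 := abs_add_le (T - (S - S') * f b) ((S - S') * (f b - f (b + 1)))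
      linarith
  have h1 := key b hab
  have h2 := abs_sum_chiFour_sub_le a b
  have h3 : |(∑ k ∈ Ioc 0 b, chiFour k - ∑ k ∈ Ioc 0 a, chiFour k) * f b| ≤ f b := by
    rw [abs_mul, abs_of_nonneg (hf0 b hab)]
    exact mul_le_of_le_one_left (hf0 b hab) h2
  have h4 := abs_sub_abs_le_abs_sub (∑ k ∈ Ioc a b, chiFour k * f k)
    ((∑ k ∈ Ioc 0 b, chiFour k - ∑ k ∈ Ioc 0 a, chiFour k) * f b)
  linarith

lemma sum_vonMangoldt_le (N : ℕ) : ∑ n ∈ Ioc 0 N, Λ n ≤ (Real.log 4 + 4) * N := by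
  have := Chebyshev.psi_le_const_mul_self (x := N) (by positivity)
  simpa [Chebyshev.psi] using this

lemma sum_log_eq (N : ℕ) : ∑ n ∈ Ioc 0 N, Real.log n = Real.log N.factorial := by
  induction N with
  | zero => simp
  | succ n ih =>
    rw [sum_Ioc_succ_top (by lia), ih, Nat.factorial_succ, Nat.cast_mul, Real.log_mul, add_comm]
    · positivity
    · positivity

/-- Mertens' first theorem for the von Mangoldt function. -/
lemma abs_sum_vonMangoldt_div_sub_log_le :
    ∃ C : ℝ, ∀ N : ℕ, 1 ≤ N → |∑ n ∈ Ioc 0 N, Λ n / n - Real.log N| ≤ C := by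
  refine ⟨Real.log 4 + 4, fun N hN => ?_⟩
  have hN0 : (0 : ℝ) < N := by exact_mod_cast hN
  have h1 : ∑ n ∈ Ioc 0 N, Real.log n = ∑ n ∈ Ioc 0 N, Λ n * ((N / n : ℕ) : ℝ) := by
    rw [← sum_Ioc_mul_zeta_eq_sum]
    refine sum_congr rfl fun n _ => ?_
    rw [vonMangoldt_mul_zeta]; simp [ArithmeticFunction.log_apply]
  rw [sum_log_eq] at h1
  have h2 : Real.log N.factorial ≤ N * Real.log N := by
    rw [← Real.log_pow]
    exact Real.log_le_log (by positivity) (by exact_mod_cast Nat.factorial_le_pow N)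
  have h3 : N * Real.log N - N ≤ Real.log N.factorial := by
    have := Stirling.le_log_factorial_stirling (n := N) (by lia)
    have h5 : 0 ≤ Real.log N := Real.log_natCast_nonneg N
    have h6 : 0 ≤ Real.log (2 * Real.pi) := Real.log_nonneg (by linarith [Real.pi_gt_three])
    linarith
  have h4 : Real.log N.factorial ≤ N * ∑ n ∈ Ioc 0 N, Λ n / n := by
    rw [h1, mul_sum]
    refine sum_le_sum fun n hn => ?_
    have := Nat.cast_div_le (α := ℝ) (m := N) (n := n)
    calc Λ n * ((N / n : ℕ) : ℝ) ≤ Λ n * (N / n) :=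
          mul_le_mul_of_nonneg_left this vonMangoldt_nonneg
      _ = _ := by ring
  have h5 : N * ∑ n ∈ Ioc 0 N, Λ n / n ≤ Real.log N.factorial + (Real.log 4 + 4) * N := by
    refine le_trans ?_ (add_le_add_right (sum_vonMangoldt_le N) _)
    rw [h1, mul_sum, ← sum_add_distrib]
    refine sum_le_sum fun n hn => ?_
    have hn0 : 0 < n := (mem_Ioc.1 hn).1
    have : (N : ℝ) / n ≤ ((N / n : ℕ) : ℝ) + 1 := by
      rw [← Nat.floor_div_eq_div (K := ℝ)]
      exact (Nat.lt_floor_add_one _).le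
    calc N * (Λ n / n) = Λ n * (N / n) := by ring
      _ ≤ Λ n * (((N / n : ℕ) : ℝ) + 1) := mul_le_mul_of_nonneg_left this vonMangoldt_nonneg
      _ = _ := by ring
  have hlog4 : 0 ≤ Real.log 4 := Real.log_nonneg (by norm_num)
  rw [abs_le]
  constructor
  · have : N * Real.log N - N ≤ N * ∑ n ∈ Ioc 0 N, Λ n / n := h3.trans h4
    nlinarith
  · have : N * ∑ n ∈ Ioc 0 N, Λ n / n ≤ N * Real.log N + (Real.log 4 + 4) * N := by linarith
    nlinarith

/-- Mertens' first theorem twisted by `chiFour`. -/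
lemma abs_sum_chiFour_mul_vonMangoldt_div_le :
    ∃ C : ℝ, ∀ N : ℕ, 1 ≤ N → |∑ n ∈ Ioc 0 N, chiFour n * Λ n / n| ≤ C := by
  have hlog : ∀ N : ℕ, |∑ n ∈ Ioc 0 N, chiFour n * (Real.log n / n)| ≤ Real.log 3 / 3 := by
    intro N
    by_cases hN : N ≤ 2
    · have : ∑ n ∈ Ioc 0 N, chiFour n * (Real.log n / n) = 0 := by
        refine sum_eq_zero fun n hn => ?_
        rw [mem_Ioc] at hn
        have : n = 1 ∨ n = 2 := by lia
        rcases this with rfl | rfl <;> simp [chiFour]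
      rw [this, abs_zero]
      have := Real.log_nonneg (x := 3) (by norm_num)
      positivity
    · have h1 : ∑ n ∈ Ioc 0 N, chiFour n * (Real.log n / n) =
          ∑ n ∈ Ioc 2 N, chiFour n * (Real.log n / n) := by
        rw [← sum_Ioc_consecutive _ (Nat.zero_le 2) (by lia : 2 ≤ N)]
        have : Ioc 0 2 = {1, 2} := by decide
        rw [this]; simp [chiFour]
      rw [h1]
      have := abs_sum_chiFour_mul_le (fun n => Real.log n / n) 2
        (fun n _ => by have := Real.log_natCast_nonneg n; positivity)
        (fun n hn => by
          have he := Real.exp_one_lt_d9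
          refine Real.log_div_self_antitoneOn ?_ ?_ (by push_cast; linarith)
          · have : (3 : ℝ) ≤ n := by exact_mod_cast hn
            simp only [Set.mem_Ici]; linarith
          · have : (3 : ℝ) ≤ n := by exact_mod_cast hn
            simp only [Set.mem_Ici]; push_cast; linarith) (by lia : 2 ≤ N)
      norm_num at this ⊢
      exact this
  have hL : ∀ M N : ℕ, M ≤ N → |∑ n ∈ Ioc 0 N, chiFour n * (1 / (n : ℝ)) -
      ∑ n ∈ Ioc 0 M, chiFour n * (1 / (n : ℝ))| ≤ 1 / ((M : ℝ) + 1) := by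
    intro M N h
    rw [← sum_Ioc_consecutive _ (Nat.zero_le M) h, add_sub_cancel_left]
    have := abs_sum_chiFour_mul_le (fun n => 1 / (n : ℝ)) M (fun n _ => by positivity)
        (fun n hn => by
          have : (0 : ℝ) < n := by exact_mod_cast (by lia : 0 < n)
          exact one_div_le_one_div_of_le this (by push_cast; linarith)) h
    simpa using this
  refine ⟨2 * (Real.log 3 / 3 + (Real.log 4 + 4)), fun N hN => ?_⟩
  have hN0 : (0 : ℝ) < N := by exact_mod_cast hN
  let f : ArithmeticFunction ℝ := ⟨fun n => chiFour n * Λ n / n, by simp⟩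
  let g : ArithmeticFunction ℝ := ⟨fun n => chiFour n * (1 / (n : ℝ)), by simp⟩
  have hfg : ∀ n, (f * g) n = chiFour n * (Real.log n / n) := by
    intro n
    rw [ArithmeticFunction.mul_apply]
    have : ∀ x ∈ n.divisorsAntidiagonal, f x.1 * g x.2 = chiFour n / n * Λ x.1 := by
      intro x hx
      obtain ⟨h1, h2⟩ := Nat.mem_divisorsAntidiagonal.1 hx
      have hx1 : (x.1 : ℝ) ≠ 0 := by
        intro h; exact h2 (by rw [← h1, Nat.cast_eq_zero.1 h, zero_mul])
      have hx2 : (x.2 : ℝ) ≠ 0 := by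
        intro h; exact h2 (by rw [← h1, Nat.cast_eq_zero.1 h, mul_zero])
      rw [← h1, chiFour_mul]
      simp only [f, g, ArithmeticFunction.coe_mk]
      push_cast
      field_simp
    rw [sum_congr rfl this, ← mul_sum, Nat.sum_divisorsAntidiagonal (fun a _ => Λ a),
      vonMangoldt_sum]
    ring
  have h1 := sum_Ioc_mul_eq_sum_sum f g N
  simp_rw [hfg] at h1
  simp only [f, g, ArithmeticFunction.coe_mk] at h1
  set LN := ∑ n ∈ Ioc 0 N, chiFour n * (1 / (n : ℝ)) with hLN
  set S := ∑ n ∈ Ioc 0 N, chiFour n * Λ n / n with hS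
  have hLN2 : 1 / 2 ≤ LN := by
    have := hL 1 N hN
    have h0 : ∑ n ∈ Ioc 0 1, chiFour n * (1 / (n : ℝ)) = 1 := by simp [chiFour]
    rw [h0, abs_le] at this
    have h12 : (1 : ℝ) / ((1 : ℕ) + 1) = 1 / 2 := by norm_num
    linarith [this.1]
  have h2 : |S * LN - ∑ n ∈ Ioc 0 N, chiFour n * (Real.log n / n)| ≤ Real.log 4 + 4 := by
    rw [h1, hS, sum_mul, ← sum_sub_distrib]
    refine (abs_sum_le_sum_abs _ _).trans ?_
    have : ∀ n ∈ Ioc 0 N, |chiFour n * Λ n / n * LN - chiFour n * Λ n / n *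
        ∑ m ∈ Ioc 0 (N / n), chiFour m * (1 / (m : ℝ))| ≤ Λ n / N := by
      intro n hn
      have hn0 : (0 : ℝ) < n := by exact_mod_cast (mem_Ioc.1 hn).1
      rw [← mul_sub, abs_mul]
      have h3 := hL (N / n) N (Nat.div_le_self _ _)
      have h4 : 1 / (((N / n : ℕ) : ℝ) + 1) ≤ n / N := by
        rw [div_le_div_iff₀ (by positivity) hN0, one_mul]
        have : (N : ℝ) / n ≤ ((N / n : ℕ) : ℝ) + 1 := by
          rw [← Nat.floor_div_eq_div (K := ℝ)]
          exact (Nat.lt_floor_add_one _).le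
        rw [div_le_iff₀ hn0] at this
        linarith
      have h5 : |chiFour n * Λ n / n| ≤ Λ n / n := by
        rw [abs_div, abs_mul, abs_of_nonneg (vonMangoldt_nonneg (n := n)), abs_of_pos hn0]
        gcongr
        exact mul_le_of_le_one_left vonMangoldt_nonneg (abs_chiFour_le_one n)
      calc _ ≤ (Λ n / n) * (n / N) := by
            apply mul_le_mul h5 (h3.trans h4) (abs_nonneg _)
            have := vonMangoldt_nonneg (n := n)
            positivity
        _ = Λ n / N := by field_simp
    refine (sum_le_sum this).trans ?_
    rw [← sum_div, div_le_iff₀ hN0]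
    exact sum_vonMangoldt_le N
  have h3 := hlog N
  have h4 : |S * LN| ≤ Real.log 3 / 3 + (Real.log 4 + 4) := by
    have := abs_sub_abs_le_abs_sub (S * LN) (∑ n ∈ Ioc 0 N, chiFour n * (Real.log n / n))
    linarith
  rw [abs_mul, abs_of_nonneg (by linarith : 0 ≤ LN)] at h4
  nlinarith [abs_nonneg S]

lemma summable_vonMangoldt_non_primes_div :
    Summable fun n : ℕ => (if n.Prime then 0 else Λ n) / n := by
  have := vonMangoldt.summable_residueClass_non_primes_div (q := 1) 0
  refine this.congr fun n => ?_
  congr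
  simp [Subsingleton.elim _ (0 : ZMod 1)]

/-- Mertens' first theorem in the invertible residue classes modulo `4`. -/
lemma abs_sum_log_div_mod_four_sub_le (c : ℕ) (hc : c = 1 ∨ c = 3) :
    ∃ C : ℝ, 0 ≤ C ∧ ∀ N : ℕ, 1 ≤ N →
      |∑ p ∈ Ioc 0 N with (p.Prime ∧ p % 4 = c), Real.log p / p - Real.log N / 2| ≤ C := by
  obtain ⟨C₁, h₁⟩ := abs_sum_vonMangoldt_div_sub_log_le
  obtain ⟨C₂, h₂⟩ := abs_sum_chiFour_mul_vonMangoldt_div_le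
  set T := ∑' n : ℕ, (if n.Prime then 0 else Λ n) / n with hT
  have hC₁ := (abs_nonneg _).trans (h₁ 1 le_rfl)
  have hC₂ := (abs_nonneg _).trans (h₂ 1 le_rfl)
  have hterm : ∀ n : ℕ, 0 ≤ (if n.Prime then 0 else Λ n) / n := fun n => by
    have := vonMangoldt_nonneg (n := n)
    split_ifs <;> positivity
  have hT0 : 0 ≤ T := tsum_nonneg hterm
  refine ⟨C₁ + C₂ + T + 1, by linarith, fun N hN => ?_⟩
  set σ : ℝ := if c = 1 then 1 else -1 with hσ
  have hσ1 : |σ| = 1 := by rw [hσ]; split_ifs <;> simp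
  have h2 : Real.log 2 / 2 ≤ 1 := by
    have := Real.log_two_lt_d9; linarith
  have hlog2 : 0 ≤ Real.log 2 / 2 := by have := Real.log_two_gt_d9; linarith
  have hdec : |∑ n ∈ Ioc 0 N, (1 + σ * chiFour n) * Λ n / n -
      2 * ∑ p ∈ Ioc 0 N with (p.Prime ∧ p % 4 = c), Real.log p / p| ≤ 2 * T + 1 := by
    rw [sum_filter, mul_sum, ← sum_sub_distrib]
    have hb : ∀ n ∈ Ioc 0 N, |(1 + σ * chiFour n) * Λ n / n -
        2 * (if n.Prime ∧ n % 4 = c then Real.log n / n else 0)| ≤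
        2 * ((if n.Prime then 0 else Λ n) / n) + if n = 2 then Real.log 2 / 2 else 0 := by
      intro n hn
      have hΛ := vonMangoldt_nonneg (n := n)
      by_cases hp : n.Prime
      · rw [vonMangoldt_apply_prime hp]
        rcases hp.eq_two_or_odd with rfl | hodd
        · have : ¬ (2 % 4 = c) := by lia
          simp [chiFour, this, abs_of_nonneg hlog2, Nat.prime_two]
        · have h4 : n % 4 = 1 ∨ n % 4 = 3 := by lia
          have hn2 : n ≠ 2 := by lia
          have : (1 + σ * chiFour n) = if n % 4 = c then 2 else 0 := by
            rw [hσ, chiFour]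
            rcases hc with rfl | rfl <;> rcases h4 with h | h <;> simp [h] <;> norm_num
          rw [this]
          by_cases h : n % 4 = c <;> simp [hp, h, hn2, mul_div_assoc]
      · simp only [hp, false_and, if_false, mul_zero, sub_zero]
        have h0 : 0 ≤ if n = 2 then Real.log 2 / 2 else 0 := by split_ifs <;> simp [hlog2]
        have : |(1 + σ * chiFour n) * Λ n / n| ≤ 2 * (Λ n / n) := by
          rw [abs_div, abs_mul, abs_of_nonneg hΛ, Nat.abs_cast, mul_div_assoc]
          gcongr
          calc |1 + σ * chiFour n| ≤ |1| + |σ * chiFour n| := abs_add_le _ _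
            _ ≤ 1 + 1 := by
              rw [abs_mul, hσ1, one_mul, abs_one]; linarith [abs_chiFour_le_one n]
            _ = 2 := by norm_num
        linarith
    refine (abs_sum_le_sum_abs _ _).trans ((sum_le_sum hb).trans ?_)
    rw [sum_add_distrib, ← mul_sum]
    have h3 : ∑ n ∈ Ioc 0 N, (if n.Prime then 0 else Λ n) / (n : ℝ) ≤ T :=
      summable_vonMangoldt_non_primes_div.sum_le_tsum _ (fun n _ => hterm n)
    have h4 : ∑ n ∈ Ioc 0 N, (if n = 2 then Real.log 2 / 2 else 0) ≤ 1 := by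
      rw [sum_ite_eq' (Ioc 0 N) 2]
      split_ifs <;> linarith
    linarith
  have hsum : ∑ n ∈ Ioc 0 N, (1 + σ * chiFour n) * Λ n / n =
      ∑ n ∈ Ioc 0 N, Λ n / n + σ * ∑ n ∈ Ioc 0 N, chiFour n * Λ n / n := by
    rw [mul_sum, ← sum_add_distrib]
    exact sum_congr rfl fun n _ => by ring
  have h3 := h₁ N hN
  have h4 : |σ * ∑ n ∈ Ioc 0 N, chiFour n * Λ n / n| ≤ C₂ := by
    rw [abs_mul, hσ1, one_mul]; exact h₂ N hN
  rw [hsum] at hdec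
  rw [abs_le] at *
  constructor <;> linarith [hdec.1, hdec.2, h3.1, h3.2, h4.1, h4.2]

/-- Mertens' second theorem in the invertible residue classes modulo `4`. -/
lemma abs_sum_inv_mod_four_sub_le (c : ℕ) (hc : c = 1 ∨ c = 3) :
    ∃ C : ℝ, 0 ≤ C ∧ ∀ N : ℕ, 2 ≤ N →
      |∑ p ∈ Ioc 0 N with (p.Prime ∧ p % 4 = c), 1 / (p : ℝ) - Real.log (Real.log N) / 2| ≤ C := by
  obtain ⟨C, hC, h⟩ := abs_sum_log_div_mod_four_sub_le c hc
  set A : ℕ → ℝ := fun N => ∑ p ∈ Ioc 0 N with (p.Prime ∧ p % 4 = c), Real.log p / p with hA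
  set B : ℕ → ℝ := fun N => ∑ p ∈ Ioc 0 N with (p.Prime ∧ p % 4 = c), 1 / (p : ℝ) with hB
  set E : ℕ → ℝ := fun N => A N - Real.log N / 2 with hE
  have hlogpos : ∀ n : ℕ, 2 ≤ n → 0 < Real.log n := fun n hn =>
    Real.log_pos (by exact_mod_cast hn)
  have hstep : ∀ n : ℕ, 2 ≤ n → B (n + 1) - B n = (A (n + 1) - A n) / Real.log (n + 1 : ℕ) := by
    intro n hn
    have := hlogpos (n + 1) (by lia)
    simp only [hA, hB, sum_filter]
    rw [sum_Ioc_succ_top (by lia), sum_Ioc_succ_top (by lia), add_sub_cancel_left,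
      add_sub_cancel_left]
    split_ifs
    · field_simp
    · simp
  set K := |B 2 - Real.log (Real.log 2) / 2 - E 2 / Real.log 2| with hK
  have key : ∀ N : ℕ, 2 ≤ N → |B N - Real.log (Real.log N) / 2 - E N / Real.log N| ≤
      K + (C + 1) * (1 / Real.log 2 - 1 / Real.log N) := by
    intro N hN
    induction N, hN using Nat.le_induction with
    | base => simp [hK]
    | succ n hn ih =>
      have hl := hlogpos n hn
      have hl' := hlogpos (n + 1) (by lia)
      have hn0 : (0 : ℝ) < n := by exact_mod_cast (by lia : 0 < n)
      have hle : Real.log n ≤ Real.log (n + 1 : ℕ) :=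
        Real.log_le_log hn0 (by push_cast; linarith)
      have hone : Real.log (n + 1 : ℕ) - Real.log n ≤ 1 := by
        rw [← Real.log_div (by positivity) (by positivity)]
        refine (Real.log_le_sub_one_of_pos (by positivity)).trans ?_
        have : (1 : ℝ) ≤ n := by exact_mod_cast (by lia : 1 ≤ n)
        rw [sub_le_iff_le_add, div_le_iff₀ hn0]; push_cast; linarith
      have hst := hstep n hn
      have hEn := h n (by lia)
      set u := Real.log n
      set v := Real.log (n + 1 : ℕ)
      have hv1 : A (n + 1) = E (n + 1) + v / 2 := by simp [hE, v]
      have hv2 : A n = E n + u / 2 := by simp [hE, u]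
      rw [hv1, hv2] at hst
      have hlog1 : Real.log v - Real.log u ≤ (v - u) / u := by
        rw [← Real.log_div hl'.ne' hl.ne']
        refine (Real.log_le_sub_one_of_pos (by positivity)).trans (le_of_eq ?_)
        field_simp
      have hlog2 : (v - u) / v ≤ Real.log v - Real.log u := by
        have h1 : Real.log (u / v) ≤ u / v - 1 := Real.log_le_sub_one_of_pos (by positivity)
        rw [Real.log_div hl.ne' hl'.ne'] at h1
        have : (v - u) / v = 1 - u / v := by field_simp
        linarith
      have huv : 0 ≤ 1 / u - 1 / v := sub_nonneg.2 (one_div_le_one_div_of_le hl hle)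
      have e1 : |(v - u) / v / 2 - (Real.log v - Real.log u) / 2| ≤ 1 / u - 1 / v := by
        have : (v - u) / u - (v - u) / v ≤ 1 / u - 1 / v := by
          have : (v - u) / u - (v - u) / v = (v - u) * (1 / u - 1 / v) := by ring
          rw [this]; exact mul_le_of_le_one_left huv hone
        rw [abs_le]; constructor <;> linarith
      have e2 : |E n * (1 / u - 1 / v)| ≤ C * (1 / u - 1 / v) := by
        rw [abs_mul, abs_of_nonneg huv]
        exact mul_le_mul_of_nonneg_right hEn huv
      have hdecomp : B (n + 1) - Real.log v / 2 - E (n + 1) / v =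
          (B n - Real.log u / 2 - E n / u) +
          (((v - u) / v / 2 - (Real.log v - Real.log u) / 2) + E n * (1 / u - 1 / v)) := by
        have : B (n + 1) = B n + (E (n + 1) + v / 2 - (E n + u / 2)) / v := by linarith
        rw [this]; ring
      rw [hdecomp]
      have a1 := abs_add_le (B n - Real.log u / 2 - E n / u)
        (((v - u) / v / 2 - (Real.log v - Real.log u) / 2) + E n * (1 / u - 1 / v))
      have a2 := abs_add_le ((v - u) / v / 2 - (Real.log v - Real.log u) / 2)
        (E n * (1 / u - 1 / v))
      linarith
  have hl2 := hlogpos 2 le_rfl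
  have hK0 : 0 ≤ K := abs_nonneg _
  refine ⟨K + (C + 1) * (1 / Real.log 2) + C / Real.log 2, by norm_num at hl2; positivity,
    fun N hN => ?_⟩
  have hl := hlogpos N hN
  have h1 := key N hN
  have h2 : |E N / Real.log N| ≤ C / Real.log 2 := by
    rw [abs_div, abs_of_pos hl]
    have : Real.log 2 ≤ Real.log N := Real.log_le_log (by norm_num) (by exact_mod_cast hN)
    norm_num at hl2
    gcongr
    exact h N (by lia)
  have h3 : (C + 1) * (1 / Real.log 2 - 1 / Real.log N) ≤ (C + 1) * (1 / Real.log 2) := by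
    have : 0 < 1 / Real.log N := by positivity
    apply mul_le_mul_of_nonneg_left _ (by linarith); linarith
  have h4 := abs_add_le (B N - Real.log (Real.log N) / 2 - E N / Real.log N) (E N / Real.log N)
  rw [sub_add_cancel] at h4
  linarith

end Mertens

section LowerBound

open Finset
open scoped Classical

lemma mem_SOS_iff_nat {n : ℕ} : n ∈ SOS ↔ ∃ a b : ℕ, n = a ^ 2 + b ^ 2 := by
  constructor
  · rintro ⟨x, y, h⟩
    refine ⟨x.natAbs, y.natAbs, ?_⟩
    zify
    simpa using h
  · rintro ⟨a, b, h⟩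
    exact ⟨a, b, by exact_mod_cast h⟩

/-- The number of sums of two squares up to `x`. -/
def countSOS (x : ℕ) : ℕ := #{m ∈ Icc 0 x | m ∈ SOS}

/-- The positive integers up to `Y` all of whose prime factors are `1` modulo `4` or lie in `S`. -/
def splitNumbers (Y : ℕ) (S : Finset ℕ) : Finset ℕ :=
  {n ∈ Icc 1 Y | ∀ p : ℕ, p.Prime → p ∣ n → p % 4 = 1 ∨ p ∈ S}

lemma mem_SOS_of_forall_prime {n : ℕ} (h : ∀ p : ℕ, p.Prime → p ∣ n → p % 4 = 1) : n ∈ SOS := by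
  rw [mem_SOS_iff_nat, Nat.eq_sq_add_sq_iff]
  intro q hq h3
  have := h q (Nat.prime_of_mem_primeFactors hq) (Nat.dvd_of_mem_primeFactors hq)
  lia

lemma sum_splitNumbers_insert_le (Y : ℕ) (S : Finset ℕ) {p : ℕ} (hp : p.Prime) :
    (∑ n ∈ splitNumbers Y (insert p S), 1 / (n : ℝ)) * (1 - 1 / p) ≤
      ∑ n ∈ splitNumbers Y S, 1 / (n : ℝ) := by
  have hp0 : (0 : ℝ) < p := by exact_mod_cast hp.pos
  set U := splitNumbers Y (insert p S) with hU
  have h1 : ∑ n ∈ U with ¬ p ∣ n, 1 / (n : ℝ) ≤ ∑ n ∈ splitNumbers Y S, 1 / (n : ℝ) := by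
    refine sum_le_sum_of_subset_of_nonneg ?_ fun _ _ _ => by positivity
    intro n hn
    simp only [hU, splitNumbers, mem_filter, mem_insert] at hn ⊢
    refine ⟨hn.1.1, fun r hr hrn => ?_⟩
    rcases hn.1.2 r hr hrn with h | h | h
    · exact Or.inl h
    · exact absurd (h ▸ hrn) hn.2
    · exact Or.inr h
  have h2 : ∑ n ∈ U with p ∣ n, 1 / (n : ℝ) ≤ (∑ n ∈ U, 1 / (n : ℝ)) * (1 / p) := by
    rw [sum_mul]
    have hmaps : ∀ n ∈ U.filter (p ∣ ·), n / p ∈ U := by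
      intro n hn
      simp only [hU, splitNumbers, mem_filter, mem_insert, mem_Icc] at hn ⊢
      obtain ⟨⟨⟨hn1, hnY⟩, hn2⟩, hpn⟩ := hn
      refine ⟨⟨Nat.div_pos (Nat.le_of_dvd hn1 hpn) hp.pos, (Nat.div_le_self _ _).trans hnY⟩, ?_⟩
      exact fun r hr hrn => hn2 r hr (hrn.trans (Nat.div_dvd_of_dvd hpn))
    have hinj : Set.InjOn (fun n => n / p) (U.filter (p ∣ ·) : Finset ℕ) := by
      intro a ha b hb hab
      simp only [coe_filter, Set.mem_ofPred_eq] at ha hb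
      exact Nat.div_left_inj ha.2 hb.2 |>.1 hab
    have hval : ∀ n ∈ U.filter (p ∣ ·), 1 / (n : ℝ) = 1 / ((n / p : ℕ) : ℝ) * (1 / p) := by
      intro n hn
      rw [mem_filter] at hn
      rw [Nat.cast_div hn.2 hp0.ne']
      field_simp
    rw [sum_congr rfl hval,
      ← sum_image (f := fun n : ℕ => 1 / (n : ℝ) * (1 / p)) hinj]
    refine sum_le_sum_of_subset_of_nonneg ?_ fun _ _ _ => by positivity
    intro m hm
    obtain ⟨n, hn, rfl⟩ := mem_image.1 hm
    exact hmaps n hn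
  have h3 := sum_filter_add_sum_filter_not U (p ∣ ·) (fun n => 1 / (n : ℝ))
  linarith

lemma sum_splitNumbers_mul_prod_le (Y : ℕ) (S : Finset ℕ) (hS : ∀ p ∈ S, p.Prime) :
    (∑ n ∈ splitNumbers Y S, 1 / (n : ℝ)) * ∏ p ∈ S, (1 - 1 / (p : ℝ)) ≤
      ∑ n ∈ splitNumbers Y ∅, 1 / (n : ℝ) := by
  induction S using Finset.induction_on with
  | empty => simp
  | insert p S hpS ih =>
    rw [prod_insert hpS, ← mul_assoc]
    refine le_trans ?_ (ih fun r hr => hS r (mem_insert_of_mem hr))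
    refine mul_le_mul_of_nonneg_right
      (sum_splitNumbers_insert_le Y S (hS p (mem_insert_self _ _))) ?_
    refine prod_nonneg fun r hr => ?_
    have : (1 : ℝ) ≤ r := by exact_mod_cast (hS r (mem_insert_of_mem hr)).one_lt.le
    rw [sub_nonneg, div_le_one (by linarith)]; exact this

lemma sum_one_div_sq_le (S : Finset ℕ) (hS : ∀ n ∈ S, 0 < n) : ∑ n ∈ S, 1 / (n : ℝ) ^ 2 ≤ 2 := by
  obtain ⟨N, hN⟩ := S.exists_nat_subset_range
  have h := sum_Ioo_inv_sq_le (α := ℝ) 0 N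
  refine le_trans ?_ (h.trans (by norm_num))
  simp only [one_div]
  refine sum_le_sum_of_subset_of_nonneg ?_ fun _ _ _ => by positivity
  intro n hn
  exact mem_Ioo.2 ⟨hS n hn, mem_range.1 (hN hn)⟩

lemma sqrt_log_le_sum_splitNumbers :
    ∃ c : ℝ, 0 < c ∧ ∀ Y : ℕ, 2 ≤ Y → c * √(Real.log Y) ≤ ∑ n ∈ splitNumbers Y ∅, 1 / (n : ℝ) := by
  obtain ⟨C, hC, h⟩ := abs_sum_inv_mod_four_sub_le 3 (Or.inr rfl)
  refine ⟨Real.exp (-(C + 5)), Real.exp_pos _, fun Y hY => ?_⟩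
  have hlog : 0 < Real.log Y := Real.log_pos (by exact_mod_cast hY)
  set S : Finset ℕ := {p ∈ Ioc 0 Y | p.Prime ∧ p % 4 ≠ 1} with hS
  have hSp : ∀ p ∈ S, p.Prime := fun p hp => (mem_filter.1 hp).2.1
  have hfull : splitNumbers Y S = Icc 1 Y := by
    refine filter_true_of_mem fun n hn p hp hpn => ?_
    rw [mem_Icc] at hn
    by_cases h4 : p % 4 = 1
    · exact Or.inl h4
    · exact Or.inr (mem_filter.2 ⟨mem_Ioc.2 ⟨hp.pos, (Nat.le_of_dvd hn.1 hpn).trans hn.2⟩, hp, h4⟩)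
  have h1 := sum_splitNumbers_mul_prod_le Y S hSp
  rw [hfull] at h1
  have hharm : Real.log Y ≤ ∑ n ∈ Icc 1 Y, 1 / (n : ℝ) := by
    have h2 := log_add_one_le_harmonic Y
    rw [harmonic_eq_sum_Icc] at h2
    push_cast at h2
    simp only [one_div]
    refine le_trans (Real.log_le_log (by positivity) (by linarith)) h2
  have hsum : ∑ p ∈ S, 1 / (p : ℝ) ≤ Real.log (Real.log Y) / 2 + C + 1 := by
    have h3 := (abs_le.1 (h Y hY)).2
    have hsub : S ⊆ insert 2 ({p ∈ Ioc 0 Y | p.Prime ∧ p % 4 = 3} : Finset ℕ) := by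
      intro p hp
      rw [hS, mem_filter] at hp
      rw [mem_insert, mem_filter]
      rcases hp.2.1.eq_two_or_odd with h2 | h2
      · exact Or.inl h2
      · exact Or.inr ⟨hp.1, hp.2.1, by lia⟩
    have h4 := sum_le_sum_of_subset_of_nonneg (f := fun p : ℕ => 1 / (p : ℝ)) hsub
      fun _ _ _ => by positivity
    rw [sum_insert (by simp)] at h4
    push_cast at h4
    linarith
  have hprod : Real.exp (-(∑ p ∈ S, 1 / (p : ℝ) + 4)) ≤ ∏ p ∈ S, (1 - 1 / (p : ℝ)) := by
    have h5 : ∑ p ∈ S, 1 / (p : ℝ) + ∑ p ∈ S, 2 * (1 / (p : ℝ) ^ 2) ≤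
        ∑ p ∈ S, 1 / (p : ℝ) + 4 := by
      rw [← mul_sum]
      linarith [sum_one_div_sq_le S fun p hp => (hSp p hp).pos]
    refine (Real.exp_le_exp.2 (neg_le_neg h5)).trans ?_
    rw [← sum_add_distrib, ← sum_neg_distrib, Real.exp_sum]
    refine prod_le_prod (fun _ _ => (Real.exp_pos _).le) fun p hp => ?_
    have hp2 : (2 : ℝ) ≤ p := by exact_mod_cast (hSp p hp).two_le
    rw [Real.exp_neg, inv_le_comm₀ (Real.exp_pos _) (by
      rw [sub_pos, div_lt_one (by linarith)]; linarith)]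
    refine le_trans ?_ (Real.add_one_le_exp _)
    rw [inv_le_iff_one_le_mul₀ (by rw [sub_pos, div_lt_one (by linarith)]; linarith)]
    have hp0 : (0 : ℝ) < 1 / p := by positivity
    have hp1 : 1 / (p : ℝ) ≤ 1 / 2 := one_div_le_one_div_of_le (by norm_num) hp2
    have : 1 / (p : ℝ) ^ 2 = (1 / p) ^ 2 := by rw [div_pow, one_pow]
    rw [this]
    nlinarith [mul_pos hp0 hp0]
  calc Real.exp (-(C + 5)) * √(Real.log Y)
      = Real.log Y * Real.exp (-(Real.log (Real.log Y) / 2 + C + 1 + 4)) := by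
        have : √(Real.log Y) = Real.log Y * Real.exp (-(Real.log (Real.log Y) / 2)) := by
          rw [Real.sqrt_eq_rpow, Real.rpow_def_of_pos hlog]
          conv_rhs => rw [← Real.exp_log hlog, ← Real.exp_add]
          congr 1
          rw [Real.log_exp]; ring
        rw [this, mul_left_comm, ← Real.exp_add]
        congr 2; ring
    _ ≤ Real.log Y * Real.exp (-(∑ p ∈ S, 1 / (p : ℝ) + 4)) := by gcongr
    _ ≤ (∑ n ∈ Icc 1 Y, 1 / (n : ℝ)) * ∏ p ∈ S, (1 - 1 / (p : ℝ)) := by gcongr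
    _ ≤ _ := h1

/-- A Chebyshev-type lower bound for primes `1` modulo `4` in `(M, K M]`. -/
lemma div_log_le_card_primes_mod_four :
    ∃ K : ℕ, 0 < K ∧ ∀ M : ℕ, 3 ≤ M →
      M / Real.log M ≤ #{p ∈ Ioc M (K * M) | p.Prime ∧ p % 4 = 1} := by
  obtain ⟨C, hC, h⟩ := abs_sum_log_div_mod_four_sub_le 1 (Or.inl rfl)
  set K := ⌈Real.exp (4 * C + 2)⌉₊ with hK
  have hK1 : Real.exp (4 * C + 2) ≤ K := Nat.le_ceil _
  have hK0 : 0 < K := Nat.ceil_pos.2 (Real.exp_pos _)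
  refine ⟨K, hK0, fun M hM => ?_⟩
  have hM0 : (0 : ℝ) < M := by exact_mod_cast (by lia : 0 < M)
  have hKR : (0 : ℝ) < K := by exact_mod_cast hK0
  have hlogM : 0 < Real.log M := Real.log_pos (by exact_mod_cast (by lia : 1 < M))
  have hlogK : 4 * C + 2 ≤ Real.log K := by
    rw [← Real.log_exp (4 * C + 2)]; exact Real.log_le_log (Real.exp_pos _) hK1
  have hle : M ≤ K * M := Nat.le_mul_of_pos_left M hK0
  have h1 := (abs_le.1 (h M (by lia))).2
  have h2 := (abs_le.1 (h (K * M) (by lia))).1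
  rw [Nat.cast_mul, Real.log_mul hKR.ne' hM0.ne'] at h2
  have h3 : ∑ p ∈ Ioc 0 (K * M) with (p.Prime ∧ p % 4 = 1), Real.log p / p =
      ∑ p ∈ Ioc 0 M with (p.Prime ∧ p % 4 = 1), Real.log p / p +
      ∑ p ∈ Ioc M (K * M) with (p.Prime ∧ p % 4 = 1), Real.log p / p := by
    simp only [sum_filter]
    rw [sum_Ioc_consecutive _ (Nat.zero_le M) hle]
  have h4 : ∑ p ∈ Ioc M (K * M) with (p.Prime ∧ p % 4 = 1), Real.log p / p ≤
      #{p ∈ Ioc M (K * M) | p.Prime ∧ p % 4 = 1} * (Real.log M / M) := by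
    rw [← nsmul_eq_mul]
    refine sum_le_card_nsmul _ _ _ fun p hp => ?_
    have hp1 : M < p := (mem_Ioc.1 (mem_filter.1 hp).1).1
    have he := Real.exp_one_lt_d9
    have hM3 : (3 : ℝ) ≤ M := by exact_mod_cast hM
    have hp1' : (M : ℝ) ≤ p := by exact_mod_cast hp1.le
    exact Real.log_div_self_antitoneOn (by simp only [Set.mem_Ici]; linarith)
      (by simp only [Set.mem_Ici]; linarith) hp1'
  have h5 : 1 ≤ (#{p ∈ Ioc M (K * M) | p.Prime ∧ p % 4 = 1} : ℝ) * (Real.log M / M) := by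
    linarith
  rw [div_le_iff₀ hlogM]
  rw [mul_div_assoc', le_div_iff₀ hM0] at h5
  linarith

/-- The lower bound `#{m ∈ 𝒩 : m ≤ x} ≫ x / √(log x)`. -/
theorem le_countSOS :
    ∃ c : ℝ, 0 < c ∧ ∀ᶠ x : ℕ in atTop, c * (x / √(Real.log x)) ≤ countSOS x := by
  obtain ⟨c, hc, hG⟩ := sqrt_log_le_sum_splitNumbers
  obtain ⟨K, hK, hprimes⟩ := div_log_le_card_primes_mod_four
  refine ⟨c / (6 * K), by positivity, ?_⟩
  have hKR : (0 : ℝ) < K := by exact_mod_cast hK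
  filter_upwards [eventually_ge_atTop (4 * K * (4 * K)), eventually_ge_atTop 16] with x hx hx16
  set Y := Nat.sqrt (Nat.sqrt x) with hY
  have hsx : 4 * K ≤ Nat.sqrt x := Nat.le_sqrt.2 hx
  have hYY : Y * Y ≤ Nat.sqrt x := Nat.sqrt_le _
  have hY2 : 2 ≤ Y := by
    rw [hY, Nat.le_sqrt, Nat.le_sqrt]; lia
  have hxY : x ≤ Y ^ 8 := by
    have h1 : Nat.sqrt x < (Y + 1) * (Y + 1) := Nat.lt_succ_sqrt _
    have h2 : x < (Nat.sqrt x + 1) * (Nat.sqrt x + 1) := Nat.lt_succ_sqrt _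
    have h3 : Y + 1 ≤ Y * Y := by nlinarith
    have h4 : Nat.sqrt x + 1 ≤ (Y * Y) * (Y * Y) := h1.trans_le (Nat.mul_le_mul h3 h3)
    calc x ≤ (Nat.sqrt x + 1) * (Nat.sqrt x + 1) := h2.le
      _ ≤ ((Y * Y) * (Y * Y)) * ((Y * Y) * (Y * Y)) := Nat.mul_le_mul h4 h4
      _ = Y ^ 8 := by ring
  have hKY : 4 * K * (Y * Y) ≤ x :=
    (Nat.mul_le_mul hsx hYY).trans (Nat.sqrt_le x)
  have hx0 : (0 : ℝ) < x := by exact_mod_cast (by lia : 0 < x)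
  have hL : 0 < Real.log x := Real.log_pos (by exact_mod_cast (by lia : 1 < x))
  have hlogY : √(Real.log x) ≤ 3 * √(Real.log Y) := by
    have h1 : Real.log x ≤ 9 * Real.log Y := by
      have h2 : Real.log x ≤ Real.log ((Y : ℝ) ^ 8) :=
        Real.log_le_log hx0 (by exact_mod_cast hxY)
      rw [Real.log_pow] at h2
      have h3 : 0 ≤ Real.log Y := Real.log_natCast_nonneg Y
      push_cast at h2
      linarith
    calc √(Real.log x) ≤ √(3 ^ 2 * Real.log Y) := Real.sqrt_le_sqrt (by linarith)
      _ = 3 * √(Real.log Y) := by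
        rw [Real.sqrt_mul (by positivity), Real.sqrt_sq (by norm_num)]
  set Q : ℕ → Finset ℕ := fun k =>
    {p ∈ Ioc (x / (K * k)) (K * (x / (K * k))) | p.Prime ∧ p % 4 = 1} with hQ
  have hk : ∀ k ∈ splitNumbers Y ∅, 1 ≤ k ∧ k ≤ Y ∧ ∀ p : ℕ, p.Prime → p ∣ k → p % 4 = 1 := by
    intro k hk
    simpa [splitNumbers, and_assoc] using hk
  have hMk : ∀ k ∈ splitNumbers Y ∅, 4 * Y ≤ x / (K * k) := by
    intro k hks
    obtain ⟨h1, h2, -⟩ := hk k hks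
    rw [Nat.le_div_iff_mul_le (by positivity)]
    calc 4 * Y * (K * k) ≤ 4 * Y * (K * Y) := by gcongr
      _ = 4 * K * (Y * Y) := by ring
      _ ≤ x := hKY
  have hcard : ∑ k ∈ splitNumbers Y ∅, #(Q k) ≤ countSOS x := by
    rw [← card_sigma]
    refine card_le_card_of_injOn (fun z => z.1 * z.2) ?_ ?_
    · rintro ⟨k, p⟩ hz
      simp only [coe_sigma, Set.mem_sigma_iff, mem_coe, hQ, mem_filter, mem_Ioc] at hz
      obtain ⟨hks, ⟨hp1, hp2⟩, hp, hp4⟩ := hz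
      simp only [coe_filter, Set.mem_ofPred_eq, mem_Icc, Nat.zero_le, true_and]
      refine ⟨?_, mem_SOS_of_forall_prime fun q hq hqd => ?_⟩
      · calc k * p ≤ k * (K * (x / (K * k))) := by gcongr
          _ = x / (K * k) * (K * k) := by ring
          _ ≤ x := Nat.div_mul_le_self _ _
      · rcases hq.dvd_mul.1 hqd with h | h
        · exact (hk k hks).2.2 q hq h
        · rwa [(Nat.prime_dvd_prime_iff_eq hq hp).1 h]
    · rintro ⟨k, p⟩ hz ⟨k', p'⟩ hz' heq
      simp only [coe_sigma, Set.mem_sigma_iff, mem_coe, hQ, mem_filter, mem_Ioc] at hz hz' heq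
      obtain ⟨hks, ⟨hp1, -⟩, hp, -⟩ := hz
      obtain ⟨hks', ⟨hp1', -⟩, hp', -⟩ := hz'
      have hpY : Y < p := by have := hMk k hks; lia
      obtain ⟨h1, h2, -⟩ := hk k' hks'
      have hpp : p = p' := by
        have hd : p ∣ k' * p' := heq ▸ Dvd.intro_left k rfl
        rcases hp.dvd_mul.1 hd with h | h
        · have := Nat.le_of_dvd (by lia) h
          lia
        · exact (Nat.prime_dvd_prime_iff_eq hp hp').1 h
      subst hpp
      have hkk : k = k' := Nat.eq_of_mul_eq_mul_right hp.pos heq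
      subst hkk
      rfl
  have hQk : ∀ k ∈ splitNumbers Y ∅, x / (2 * K * Real.log x) * (1 / (k : ℝ)) ≤ #(Q k) := by
    intro k hks
    obtain ⟨h1, h2, -⟩ := hk k hks
    have hM := hMk k hks
    set M := x / (K * k) with hMdef
    have hkR : (0 : ℝ) < k := by exact_mod_cast h1
    have hM0 : (0 : ℝ) < M := by exact_mod_cast (by lia : 0 < M)
    have hlogM : 0 < Real.log M := Real.log_pos (by exact_mod_cast (by lia : 1 < M))
    have hMx : Real.log M ≤ Real.log x :=
      Real.log_le_log hM0 (by exact_mod_cast Nat.div_le_self _ _)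
    have hxM : (x : ℝ) ≤ M * (2 * (K * k)) := by
      have h3 : x < (M + 1) * (K * k) := by
        have := Nat.lt_div_mul_add (a := x) (b := K * k) (by positivity)
        lia
      have h4 : x ≤ M * (2 * (K * k)) := by
        have : 0 < K * k := by positivity
        nlinarith
      exact_mod_cast h4
    calc x / (2 * K * Real.log x) * (1 / (k : ℝ))
        = x / (2 * (K * k)) / Real.log x := by field_simp
      _ ≤ M / Real.log x := by
        gcongr
        rwa [div_le_iff₀ (by positivity)]
      _ ≤ M / Real.log M := by gcongr
      _ ≤ #(Q k) := hprimes M (by lia)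
  calc c / (6 * K) * (x / √(Real.log x))
      = x / (2 * K * Real.log x) * (c * (√(Real.log x) / 3)) := by
        have hs : √(Real.log x) * √(Real.log x) = Real.log x := Real.mul_self_sqrt hL.le
        have hs0 : 0 < √(Real.log x) := Real.sqrt_pos.2 hL
        nth_rewrite 2 [← hs]
        field_simp
        norm_num
    _ ≤ x / (2 * K * Real.log x) * (c * √(Real.log Y)) := by
        gcongr
        linarith
    _ ≤ x / (2 * K * Real.log x) * ∑ k ∈ splitNumbers Y ∅, 1 / (k : ℝ) := by
        gcongr
        exact hG Y hY2
    _ = ∑ k ∈ splitNumbers Y ∅, x / (2 * K * Real.log x) * (1 / (k : ℝ)) := mul_sum _ _ _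
    _ ≤ ∑ k ∈ splitNumbers Y ∅, (#(Q k) : ℝ) := sum_le_sum hQk
    _ ≤ countSOS x := by exact_mod_cast hcard

end LowerBound

section BrunSieve

open Finset
open scoped Classical

/-- Bonferroni's inequality: truncating inclusion-exclusion at an even level overcounts. -/
lemma indicator_empty_le_alternating_sum {α : Type*} (W : Finset α) [Decidable (W = ∅)] {r : ℕ}
    (hr : Even r) : (if W = ∅ then 1 else 0 : ℤ) ≤ ∑ D ∈ W.powerset with #D ≤ r, (-1 : ℤ) ^ #D := by
  have hsum : ∑ D ∈ W.powerset with #D ≤ r, (-1 : ℤ) ^ #D =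
      ∑ k ∈ range (r + 1), (-1 : ℤ) ^ k * (#W).choose k := by
    rw [← sum_fiberwise_of_maps_to (t := range (r + 1)) (g := card)
      (fun D hD => by simp only [mem_filter] at hD; simp; lia)]
    refine sum_congr rfl fun k hk => ?_
    have hset : {D ∈ {D ∈ W.powerset | #D ≤ r} | #D = k} = powersetCard k W := by
      ext D
      simp only [mem_filter, mem_powerset, mem_powersetCard, mem_range] at hk ⊢
      constructor
      · rintro ⟨⟨h1, -⟩, h2⟩; exact ⟨h1, h2⟩
      · rintro ⟨h1, h2⟩; exact ⟨⟨h1, by lia⟩, h2⟩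
    rw [hset, sum_congr rfl (g := fun _ => (-1 : ℤ) ^ k)
      (fun D hD => by rw [(mem_powersetCard.1 hD).2]), sum_const, card_powersetCard,
      nsmul_eq_mul, mul_comm]
  rw [hsum]
  rcases Nat.eq_zero_or_eq_succ_pred (#W) with h0 | h0
  · have hW : W = ∅ := card_eq_zero.1 h0
    subst hW
    simp [sum_range_succ']
  · have hW : W ≠ ∅ := by
      rintro rfl
      simp at h0
    rw [if_neg hW, h0, Nat.succ_eq_add_one, Int.alternating_sum_range_choose_eq_choose,
      hr.neg_one_pow, one_mul]
    positivity

/-- Brun's pure sieve in abstract form. -/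
lemma card_sifted_le {α : Type*} (A : Finset α) (P : Finset ℕ) (E : ℕ → α → Prop) {X R : ℝ}
    (hX : 0 ≤ X) (g : ℕ → ℝ) (hg : ∀ p ∈ P, 0 ≤ g p ∧ g p ≤ 1) {r : ℕ} (hr : Even r)
    (h : ∀ D ⊆ P, #D ≤ r → |(#{a ∈ A | ∀ p ∈ D, E p a} : ℝ) - X * ∏ p ∈ D, g p| ≤ R) :
    (#{a ∈ A | ∀ p ∈ P, ¬ E p a} : ℝ) ≤
      X * (Real.exp (-∑ p ∈ P, g p) + Real.exp (-r + 3 * ∑ p ∈ P, g p)) +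
        R * #{D ∈ P.powerset | #D ≤ r} := by
  set 𝒟 := {D ∈ P.powerset | #D ≤ r} with h𝒟
  have h1 : (#{a ∈ A | ∀ p ∈ P, ¬ E p a} : ℝ) ≤
      ∑ D ∈ 𝒟, (-1 : ℝ) ^ #D * #{a ∈ A | ∀ p ∈ D, E p a} := by
    have hZ : (#{a ∈ A | ∀ p ∈ P, ¬ E p a} : ℤ) ≤
        ∑ D ∈ 𝒟, (-1 : ℤ) ^ #D * #{a ∈ A | ∀ p ∈ D, E p a} := by
      calc (#{a ∈ A | ∀ p ∈ P, ¬ E p a} : ℤ)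
          = ∑ a ∈ A, (if ({p ∈ P | E p a} : Finset ℕ) = ∅ then 1 else 0 : ℤ) := by
            rw [card_filter]
            push_cast
            refine sum_congr rfl fun a _ => ?_
            simp only [filter_eq_empty_iff]
        _ ≤ ∑ a ∈ A, ∑ D ∈ ({p ∈ P | E p a} : Finset ℕ).powerset with #D ≤ r, (-1 : ℤ) ^ #D :=
            sum_le_sum fun a _ => indicator_empty_le_alternating_sum _ hr
        _ = ∑ a ∈ A, ∑ D ∈ 𝒟, if ∀ p ∈ D, E p a then (-1 : ℤ) ^ #D else 0 := by
            refine sum_congr rfl fun a _ => ?_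
            rw [← sum_filter]
            refine sum_congr ?_ fun _ _ => rfl
            ext D
            simp only [h𝒟, mem_filter, mem_powerset, subset_iff]
            grind
        _ = ∑ D ∈ 𝒟, (-1 : ℤ) ^ #D * #{a ∈ A | ∀ p ∈ D, E p a} := by
            rw [sum_comm]
            refine sum_congr rfl fun D _ => ?_
            rw [← sum_filter, sum_const, nsmul_eq_mul, mul_comm]
    exact_mod_cast hZ
  have h2 : ∑ D ∈ 𝒟, (-1 : ℝ) ^ #D * #{a ∈ A | ∀ p ∈ D, E p a} ≤
      X * ∑ D ∈ 𝒟, (-1 : ℝ) ^ #D * ∏ p ∈ D, g p + R * #𝒟 := by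
    rw [mul_sum, mul_comm R, ← nsmul_eq_mul, ← sum_const, ← sum_add_distrib]
    refine sum_le_sum fun D hD => ?_
    simp only [h𝒟, mem_filter, mem_powerset] at hD
    have := abs_le.1 (h D hD.1 hD.2)
    rcases neg_one_pow_eq_or ℝ (#D) with h | h <;> rw [h] <;> linarith
  have h3 : ∑ D ∈ 𝒟, (-1 : ℝ) ^ #D * ∏ p ∈ D, g p + ∑ D ∈ P.powerset with ¬ #D ≤ r,
      (-1 : ℝ) ^ #D * ∏ p ∈ D, g p = ∏ p ∈ P, (1 - g p) := by
    rw [h𝒟, sum_filter_add_sum_filter_not]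
    simp only [sub_eq_add_neg]
    rw [prod_one_add]
    exact sum_congr rfl fun D _ => by rw [prod_neg]
  have h4 : ∏ p ∈ P, (1 - g p) ≤ Real.exp (-∑ p ∈ P, g p) := by
    rw [← sum_neg_distrib, Real.exp_sum]
    exact prod_le_prod (fun p hp => by linarith [(hg p hp).2])
      fun p _ => Real.one_sub_le_exp_neg _
  have h5 : -∑ D ∈ P.powerset with ¬ #D ≤ r, (-1 : ℝ) ^ #D * ∏ p ∈ D, g p ≤
      Real.exp (-r + 3 * ∑ p ∈ P, g p) := by
    have hnn : ∀ D ∈ P.powerset, 0 ≤ ∏ p ∈ D, g p := fun D hD =>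
      prod_nonneg fun p hp => (hg p (mem_powerset.1 hD hp)).1
    rw [← sum_neg_distrib]
    calc ∑ D ∈ P.powerset with ¬ #D ≤ r, -((-1 : ℝ) ^ #D * ∏ p ∈ D, g p)
        ≤ ∑ D ∈ P.powerset with ¬ #D ≤ r, Real.exp (-r) * ∏ p ∈ D, (Real.exp 1 * g p) := by
          refine sum_le_sum fun D hD => ?_
          rw [mem_filter] at hD
          have h0 := hnn D hD.1
          have h6 : -((-1 : ℝ) ^ #D * ∏ p ∈ D, g p) ≤ ∏ p ∈ D, g p := by
            rcases neg_one_pow_eq_or ℝ (#D) with h | h <;> rw [h] <;> linarith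
          refine h6.trans ?_
          rw [prod_mul_distrib, prod_const, ← Real.exp_nat_mul, ← mul_assoc, ← Real.exp_add]
          refine le_mul_of_one_le_left h0 (Real.one_le_exp ?_)
          have : (r : ℝ) ≤ #D := by exact_mod_cast (not_le.1 hD.2).le
          linarith
      _ ≤ ∑ D ∈ P.powerset, Real.exp (-r) * ∏ p ∈ D, (Real.exp 1 * g p) := by
          refine sum_le_sum_of_subset_of_nonneg (filter_subset _ _) fun D hD _ => ?_
          rw [prod_mul_distrib]
          have := hnn D hD
          positivity
      _ = Real.exp (-r) * ∏ p ∈ P, (1 + Real.exp 1 * g p) := by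
          rw [← mul_sum, prod_one_add]
      _ ≤ Real.exp (-r) * Real.exp (3 * ∑ p ∈ P, g p) := by
          refine mul_le_mul_of_nonneg_left ?_ (Real.exp_pos _).le
          rw [mul_sum, Real.exp_sum]
          refine prod_le_prod (fun p hp => ?_) fun p hp => ?_
          · have := (hg p hp).1
            positivity
          · have h7 := Real.add_one_le_exp (3 * g p)
            have h8 := Real.exp_one_lt_d9
            nlinarith [(hg p hp).1]
      _ = Real.exp (-r + 3 * ∑ p ∈ P, g p) := by rw [← Real.exp_add]
  have h6 : X * ∑ D ∈ 𝒟, (-1 : ℝ) ^ #D * ∏ p ∈ D, g p ≤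
      X * (Real.exp (-∑ p ∈ P, g p) + Real.exp (-r + 3 * ∑ p ∈ P, g p)) :=
    mul_le_mul_of_nonneg_left (by linarith) hX
  linarith

lemma sum_range_mul_of_periodic (f : ℕ → ℕ) (d q : ℕ) (hf : ∀ a, f (a + d) = f a) :
    ∑ a ∈ range (q * d), f a = q * ∑ a ∈ range d, f a := by
  have hper : ∀ k a, f (k * d + a) = f a := by
    intro k
    induction k with
    | zero => simp
    | succ k ih => intro a; rw [show (k + 1) * d + a = k * d + a + d by ring, hf, ih]
  induction q with
  | zero => simp
  | succ k ih =>
    rw [add_one_mul, sum_range_add, ih]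
    simp only [hper]
    ring

/-- The number of pairs of residues modulo `d` satisfying `F`. -/
def residueCount (d : ℕ) (F : ℕ → ℕ → Prop) : ℕ := #{z ∈ range d ×ˢ range d | F z.1 z.2}

/-- A relation on pairs of integers that depends only on the residues modulo `d`. -/
def PeriodicMod (d : ℕ) (F : ℕ → ℕ → Prop) : Prop :=
  ∀ a b, F (a + d) b = F a b ∧ F a (b + d) = F a b

lemma PeriodicMod.mod {d : ℕ} {F : ℕ → ℕ → Prop} (hF : PeriodicMod d F) (a b : ℕ) :
    F (a % d) (b % d) ↔ F a b := by
  have h1 : ∀ b, Function.Periodic (fun a => F a b) d := fun b a => (hF a b).1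
  have h2 : ∀ a, Function.Periodic (fun b => F a b) d := fun a b => (hF a b).2
  have h3 := (h1 (b % d)).map_mod_nat a
  have h4 := (h2 a).map_mod_nat b
  simp only [eq_iff_iff] at h3 h4
  rw [h3, h4]

lemma PeriodicMod.of_dvd {d m : ℕ} {F : ℕ → ℕ → Prop} (hF : PeriodicMod d F) (h : d ∣ m) :
    PeriodicMod m F := by
  obtain ⟨k, rfl⟩ := h
  intro a b
  constructor
  · rw [eq_iff_iff, ← hF.mod, ← hF.mod a]; simp
  · rw [eq_iff_iff, ← hF.mod, ← hF.mod a]; simp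

lemma residueCount_mul_left {d : ℕ} {F : ℕ → ℕ → Prop} (hF : PeriodicMod d F) (q : ℕ) :
    residueCount (q * d) F = q ^ 2 * residueCount d F := by
  have hcount : ∀ n, residueCount n F = ∑ a ∈ range n, ∑ b ∈ range n, if F a b then 1 else 0 := by
    intro n
    rw [residueCount, card_filter, sum_product]
  rw [hcount, hcount]
  have h1 : ∀ a, ∑ b ∈ range (q * d), (if F a b then 1 else 0) =
      q * ∑ b ∈ range d, if F a b then 1 else 0 := fun a =>
    sum_range_mul_of_periodic _ d q fun b => by simp only [(hF a b).2]
  simp only [h1, ← mul_sum]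
  rw [sum_range_mul_of_periodic (fun a => ∑ b ∈ range d, if F a b then 1 else 0) d q
    fun a => by simp only [(hF a _).1]]
  ring

lemma residueCount_mul_of_coprime {m n : ℕ} (hm : m ≠ 0) (hn : n ≠ 0) (hmn : m.Coprime n)
    {F G : ℕ → ℕ → Prop} (hF : PeriodicMod m F) (hG : PeriodicMod n G) :
    residueCount (m * n) (fun a b => F a b ∧ G a b) = residueCount m F * residueCount n G := by
  rw [residueCount, residueCount, residueCount, ← card_product]
  refine card_bij (fun z _ => ((z.1 % m, z.2 % m), (z.1 % n, z.2 % n))) ?_ ?_ ?_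
  · rintro ⟨a, b⟩ h
    simp only [mem_filter, mem_product, mem_range] at h ⊢
    refine ⟨⟨⟨Nat.mod_lt _ (by lia), Nat.mod_lt _ (by lia)⟩, (hF.mod _ _).2 h.2.1⟩,
      ⟨Nat.mod_lt _ (by lia), Nat.mod_lt _ (by lia)⟩, (hG.mod _ _).2 h.2.2⟩
  · rintro ⟨a, b⟩ h ⟨a', b'⟩ h' heq
    simp only [mem_filter, mem_product, mem_range, Prod.mk.injEq] at h h' heq ⊢
    exact ⟨((Nat.modEq_and_modEq_iff_modEq_mul hmn).1 ⟨heq.1.1, heq.2.1⟩).eq_of_lt_of_lt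
        h.1.1 h'.1.1,
      ((Nat.modEq_and_modEq_iff_modEq_mul hmn).1 ⟨heq.1.2, heq.2.2⟩).eq_of_lt_of_lt
        h.1.2 h'.1.2⟩
  · rintro ⟨⟨a, b⟩, ⟨a', b'⟩⟩ h
    simp only [mem_filter, mem_product, mem_range] at h
    obtain ⟨⟨⟨ha, hb⟩, hFab⟩, ⟨ha', hb'⟩, hGab⟩ := h
    have hx := (Nat.chineseRemainder hmn a a').2
    have hy := (Nat.chineseRemainder hmn b b').2
    have hx' := Nat.chineseRemainder_lt_mul hmn a a' hm hn
    have hy' := Nat.chineseRemainder_lt_mul hmn b b' hm hn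
    set x : ℕ := (Nat.chineseRemainder hmn a a' : ℕ)
    set y : ℕ := (Nat.chineseRemainder hmn b b' : ℕ)
    have e1 : x % m = a := (Nat.mod_eq_of_lt ha) ▸ hx.1
    have e2 : x % n = a' := (Nat.mod_eq_of_lt ha') ▸ hx.2
    have e3 : y % m = b := (Nat.mod_eq_of_lt hb) ▸ hy.1
    have e4 : y % n = b' := (Nat.mod_eq_of_lt hb') ▸ hy.2
    refine ⟨(x, y), ?_, by simp only [e1, e2, e3, e4]⟩
    simp only [mem_filter, mem_product, mem_range]
    exact ⟨⟨hx', hy'⟩, by rw [← hF.mod, e1, e3]; exact hFab, by rw [← hG.mod, e2, e4]; exact hGab⟩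

lemma periodicMod_prod {D : Finset ℕ} {E : ℕ → ℕ → ℕ → Prop} (hE : ∀ p ∈ D, PeriodicMod p (E p)) :
    PeriodicMod (∏ p ∈ D, p) (fun a b => ∀ p ∈ D, E p a b) := by
  intro a b
  have h : ∀ p ∈ D, PeriodicMod (∏ p ∈ D, p) (E p) := fun p hp =>
    (hE p hp).of_dvd (dvd_prod_of_mem _ hp)
  exact ⟨propext (forall₂_congr fun p hp => (h p hp a b).1.to_iff),
    propext (forall₂_congr fun p hp => (h p hp a b).2.to_iff)⟩

lemma residueCount_prod {D : Finset ℕ} (hD : ∀ p ∈ D, p.Prime) {E : ℕ → ℕ → ℕ → Prop}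
    (hE : ∀ p ∈ D, PeriodicMod p (E p)) :
    residueCount (∏ p ∈ D, p) (fun a b => ∀ p ∈ D, E p a b) =
      ∏ p ∈ D, residueCount p (E p) := by
  induction D using Finset.induction_on with
  | empty => simp [residueCount]
  | insert p D hp ih =>
    have hD' : ∀ q ∈ D, q.Prime := fun q hq => hD q (mem_insert_of_mem hq)
    have hE' : ∀ q ∈ D, PeriodicMod q (E q) := fun q hq => hE q (mem_insert_of_mem hq)
    have hpp := hD p (mem_insert_self _ _)
    rw [prod_insert hp, prod_insert hp, ← ih hD' hE', ← residueCount_mul_of_coprime hpp.ne_zero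
      (prod_ne_zero_iff.2 fun q hq => (hD' q hq).ne_zero) ?_ (hE p (mem_insert_self _ _))
      (periodicMod_prod hE')]
    · simp only [forall_mem_insert]
    · refine Nat.Coprime.prod_right fun q hq => ?_
      exact (Nat.coprime_primes hpp (hD' q hq)).2 fun h => hp (h ▸ hq)

lemma residueCount_mono {m n : ℕ} (h : m ≤ n) (F : ℕ → ℕ → Prop) :
    residueCount m F ≤ residueCount n F := by
  refine card_le_card (filter_subset_filter _ ?_)
  exact product_subset_product (range_mono h) (range_mono h)

lemma residueCount_le (d : ℕ) (F : ℕ → ℕ → Prop) : residueCount d F ≤ d ^ 2 := by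
  refine (card_filter_le _ _).trans ?_
  simp [sq]

lemma abs_residueCount_sub_le {d N : ℕ} (hd : 0 < d) (hdN : d ≤ N) {F : ℕ → ℕ → Prop}
    (hF : PeriodicMod d F) :
    |(residueCount N F : ℝ) - N ^ 2 * (residueCount d F / d ^ 2)| ≤ 3 * N * d := by
  set q := N / d with hq
  have hdR : (0 : ℝ) < d := by exact_mod_cast hd
  have h1 : q * d ≤ N := Nat.div_mul_le_self _ _
  have h2 : N ≤ (q + 1) * d := by
    have := Nat.lt_div_mul_add (a := N) (b := d) hd
    lia
  have h3 : (q : ℝ) ^ 2 * residueCount d F ≤ residueCount N F := by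
    have := residueCount_mono h1 F
    rw [residueCount_mul_left hF] at this
    exact_mod_cast this
  have h4 : (residueCount N F : ℝ) ≤ ((q : ℝ) + 1) ^ 2 * residueCount d F := by
    have := residueCount_mono h2 F
    rw [residueCount_mul_left hF] at this
    exact_mod_cast this
  have h5 : (residueCount d F : ℝ) ≤ d ^ 2 := by exact_mod_cast residueCount_le d F
  have h1' : (q : ℝ) ≤ N / d := by rw [le_div_iff₀ hdR]; exact_mod_cast h1
  have h2' : (N : ℝ) / d ≤ q + 1 := by rw [div_le_iff₀ hdR]; exact_mod_cast h2
  have hc : (0 : ℝ) ≤ residueCount d F := Nat.cast_nonneg _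
  have hq0 : (0 : ℝ) ≤ q := Nat.cast_nonneg _
  have h6 : (N : ℝ) ^ 2 * (residueCount d F / d ^ 2) = (N / d : ℝ) ^ 2 * residueCount d F := by
    field_simp
  have h7 : (q : ℝ) ^ 2 * residueCount d F ≤ (N / d : ℝ) ^ 2 * residueCount d F := by gcongr
  have h8 : (N / d : ℝ) ^ 2 * residueCount d F ≤ ((q : ℝ) + 1) ^ 2 * residueCount d F := by
    gcongr
  have h9 : ((q : ℝ) + 1) ^ 2 * residueCount d F - (q : ℝ) ^ 2 * residueCount d F ≤ 3 * N * d := by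
    have h10 : ((q : ℝ) + 1) ^ 2 * residueCount d F - (q : ℝ) ^ 2 * residueCount d F =
      (2 * q + 1) * residueCount d F := by ring
    have h11 : (2 * q + 1 : ℝ) * residueCount d F ≤ (2 * q + 1) * d ^ 2 := by gcongr
    have h12 : (q : ℝ) * d ≤ N := by exact_mod_cast h1
    have h13 : (d : ℝ) ≤ N := by exact_mod_cast hdN
    nlinarith
  rw [h6, abs_le]
  constructor <;> linarith

/-- Brun's sieve for pairs of integers in a square avoiding residue classes modulo primes. -/
lemma residueCount_sifted_le {N Z r : ℕ} (hr : Even r) (hZN : Z ^ r ≤ N) {P : Finset ℕ}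
    (hP : ∀ p ∈ P, p.Prime ∧ p ≤ Z) {E : ℕ → ℕ → ℕ → Prop} (hE : ∀ p ∈ P, PeriodicMod p (E p)) :
    (residueCount N (fun a b => ∀ p ∈ P, ¬ E p a b) : ℝ) ≤
      (N : ℝ) ^ 2 * (Real.exp (-∑ p ∈ P, (residueCount p (E p) / p ^ 2 : ℝ)) +
        Real.exp (-r + 3 * ∑ p ∈ P, (residueCount p (E p) / p ^ 2 : ℝ))) +
        3 * N * Z ^ (2 * r) := by
  rcases P.eq_empty_or_nonempty with rfl | ⟨p₀, hp₀⟩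
  · have h1 : (residueCount N (fun a b => ∀ p ∈ (∅ : Finset ℕ), ¬ E p a b) : ℝ) ≤ N ^ 2 := by
      exact_mod_cast residueCount_le _ _
    have h2 : 0 ≤ (N : ℝ) ^ 2 * Real.exp (-r) := by positivity
    have h3 : 0 ≤ 3 * (N : ℝ) * Z ^ (2 * r) := by positivity
    simp only [sum_empty, neg_zero, Real.exp_zero, mul_zero, add_zero]
    linarith
  have hZ : 1 ≤ Z := (hP p₀ hp₀).1.one_lt.le.trans (hP p₀ hp₀).2
  have hprod : ∀ D ⊆ P, #D ≤ r → ∏ p ∈ D, p ≤ Z ^ r := fun D hD hDr =>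
    (prod_le_pow_card _ _ _ fun p hp => (hP p (hD hp)).2).trans (Nat.pow_le_pow_right hZ hDr)
  have hcard : (#{D ∈ P.powerset | #D ≤ r} : ℝ) ≤ Z ^ r := by
    have : #{D ∈ P.powerset | #D ≤ r} ≤ #(Icc 1 (Z ^ r)) := by
      refine card_le_card_of_injOn (fun D => ∏ p ∈ D, p) ?_ ?_
      · intro D hD
        simp only [coe_filter, mem_powerset, Set.mem_ofPred_eq] at hD
        simp only [coe_Icc, Set.mem_Icc]
        exact ⟨prod_pos fun p hp => (hP p (hD.1 hp)).1.pos, hprod D hD.1 hD.2⟩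
      · intro D hD D' hD' heq
        simp only [coe_filter, mem_powerset, Set.mem_ofPred_eq] at hD hD' heq
        rw [← Nat.primeFactors_prod fun p hp => (hP p (hD.1 hp)).1, heq,
          Nat.primeFactors_prod fun p hp => (hP p (hD'.1 hp)).1]
    rw [Nat.card_Icc, Nat.add_sub_cancel] at this
    exact_mod_cast this
  have key := card_sifted_le (range N ×ˢ range N) P (fun p z => E p z.1 z.2)
    (X := (N : ℝ) ^ 2) (R := 3 * N * Z ^ r) (by positivity)
    (fun p => (residueCount p (E p) / p ^ 2 : ℝ)) (fun p hp => ⟨by positivity, ?_⟩) hr ?_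
  · refine (le_of_eq ?_).trans (key.trans ?_)
    · unfold residueCount
      congr
    have h1 : 3 * (N : ℝ) * Z ^ r * #{D ∈ P.powerset | #D ≤ r} ≤ 3 * N * Z ^ r * Z ^ r := by gcongr
    have h2 : 3 * (N : ℝ) * Z ^ r * Z ^ r = 3 * N * Z ^ (2 * r) := by ring
    linarith
  · have hp0 : (0 : ℝ) < p := by exact_mod_cast (hP p hp).1.pos
    rw [div_le_one (by positivity)]
    exact_mod_cast residueCount_le _ _
  · intro D hD hDr
    have hDp : ∀ p ∈ D, p.Prime := fun p hp => (hP p (hD hp)).1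
    have hDE : ∀ p ∈ D, PeriodicMod p (E p) := fun p hp => hE p (hD hp)
    have h1 := abs_residueCount_sub_le (prod_pos fun p hp => (hDp p hp).pos)
      ((hprod D hD hDr).trans hZN) (periodicMod_prod hDE)
    rw [residueCount_prod hDp hDE] at h1
    push_cast at h1
    rw [← prod_pow, ← prod_div_distrib] at h1
    refine (le_of_eq ?_).trans (h1.trans ?_)
    · unfold residueCount
      congr
    have : (∏ p ∈ D, (p : ℝ)) ≤ Z ^ r := by
      rw [← Nat.cast_prod, ← Nat.cast_pow]
      exact Nat.cast_le.2 (hprod D hD hDr)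
    gcongr

end BrunSieve

section LocalCounts

open Finset
open scoped Classical

/-- Modulo a prime `p ≡ 3 mod 4`, every nonzero residue is a sum of two squares in `p + 1` ways. -/
lemma card_sq_add_sq_eq {p : ℕ} [Fact p.Prime] (hp : p % 4 = 3) {c : ZMod p} (hc : c ≠ 0) :
    #{z : ZMod p × ZMod p | z.1 ^ 2 + z.2 ^ 2 = c} = p + 1 := by
  set f : ZMod p → ℕ := fun c => #{z : ZMod p × ZMod p | z.1 ^ 2 + z.2 ^ 2 = c} with hf
  have hle : ∀ c t : ZMod p, t ≠ 0 → f c ≤ f (c * t) := by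
    intro c t ht
    obtain ⟨u, v, huv⟩ := ZMod.sq_add_sq p t
    refine card_le_card_of_injOn (fun z => (z.1 * u - z.2 * v, z.1 * v + z.2 * u)) ?_ ?_
    · intro z hz
      simp only [coe_filter, mem_univ, true_and, Set.mem_ofPred_eq] at hz ⊢
      rw [← hz, ← huv]
      ring
    · rintro ⟨a, b⟩ - ⟨a', b'⟩ - heq
      simp only [Prod.mk.injEq] at heq ⊢
      have h1 : (a - a') * t = 0 := by
        rw [← huv]; linear_combination u * heq.1 + v * heq.2
      have h2 : (b - b') * t = 0 := by
        rw [← huv]; linear_combination u * heq.2 - v * heq.1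
      exact ⟨sub_eq_zero.1 ((mul_eq_zero.1 h1).resolve_right ht),
        sub_eq_zero.1 ((mul_eq_zero.1 h2).resolve_right ht)⟩
  have hconst : ∀ d : ZMod p, d ≠ 0 → f d = f c := by
    intro d hd
    refine le_antisymm ?_ ?_
    · simpa [mul_div_cancel₀, hd] using hle d (c / d) (div_ne_zero hc hd)
    · simpa [mul_div_cancel₀, hc] using hle c (d / c) (div_ne_zero hd hc)
  have hzero : f 0 = 1 := by
    rw [hf, card_eq_one]
    refine ⟨(0, 0), ?_⟩
    ext ⟨a, b⟩
    simp only [mem_filter, mem_univ, true_and, mem_singleton, Prod.mk.injEq]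
    refine ⟨fun h => ?_, by rintro ⟨rfl, rfl⟩; simp⟩
    have hb : b = 0 := by
      by_contra hb
      have : IsSquare (-1 : ZMod p) := ⟨a / b, by field_simp; linear_combination -h⟩
      rw [ZMod.exists_sq_eq_neg_one_iff] at this
      exact this hp
    subst hb
    simpa using h
  have hsum : ∑ d : ZMod p, f d = p ^ 2 := by
    have := card_eq_sum_card_fiberwise (s := (univ : Finset (ZMod p × ZMod p)))
      (t := (univ : Finset (ZMod p))) (f := fun z => z.1 ^ 2 + z.2 ^ 2) (by simp)
    rw [← this]
    simp [ZMod.card, sq]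
  rw [← add_sum_erase _ _ (mem_univ (0 : ZMod p)), hzero,
    sum_congr rfl (fun d hd => hconst d (ne_of_mem_erase hd)), sum_const,
    card_erase_of_mem (mem_univ _), card_univ, ZMod.card, smul_eq_mul] at hsum
  change f c = p + 1
  have h2 : 1 < p := (Fact.out : p.Prime).one_lt
  obtain ⟨k, rfl⟩ : ∃ k, p = k + 2 := ⟨p - 2, by lia⟩
  have h3 : (k + 1) * f c = (k + 1) * (k + 2 + 1) := by
    simp only [show k + 2 - 1 = k + 1 by lia] at hsum
    nlinarith
  exact Nat.eq_of_mul_eq_mul_left (by lia) h3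

lemma residueCount_eq_card_zmod {p : ℕ} [NeZero p] (F : ZMod p → ZMod p → Prop) :
    residueCount p (fun a b => F a b) = #{z : ZMod p × ZMod p | F z.1 z.2} := by
  refine card_bij (fun z _ => ((z.1 : ZMod p), (z.2 : ZMod p))) ?_ ?_ ?_
  · intro z hz
    simp only [mem_filter, mem_univ, true_and] at hz ⊢
    exact hz.2
  · rintro ⟨a, b⟩ h ⟨a', b'⟩ h' heq
    simp only [mem_filter, mem_product, mem_range, Prod.mk.injEq] at h h' heq ⊢
    rw [ZMod.natCast_eq_natCast_iff', ZMod.natCast_eq_natCast_iff', Nat.mod_eq_of_lt h.1.1,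
      Nat.mod_eq_of_lt h.1.2, Nat.mod_eq_of_lt h'.1.1, Nat.mod_eq_of_lt h'.1.2] at heq
    exact heq
  · rintro ⟨a, b⟩ h
    simp only [mem_filter, mem_univ, true_and] at h
    refine ⟨(a.val, b.val), ?_, by simp⟩
    simp only [mem_filter, mem_product, mem_range, ZMod.natCast_zmod_val]
    exact ⟨⟨ZMod.val_lt a, ZMod.val_lt b⟩, h⟩

lemma periodicMod_zmod {p : ℕ} (F : ZMod p → ZMod p → Prop) :
    PeriodicMod p (fun a b => F a b) := by
  intro a b
  simp

/-- The relation `p ∣ a² + b² - h` on residues. -/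
def sqAddSqRel (h : ℤ) (p a b : ℕ) : Prop := (a : ZMod p) ^ 2 + (b : ZMod p) ^ 2 = (h : ZMod p)

/-- The relation `p ∣ a (a + h)` on residues; the second coordinate is unused. -/
def shiftRel (h : ℕ) (p a _b : ℕ) : Prop := (a : ZMod p) = 0 ∨ (a : ZMod p) = -(h : ZMod p)

lemma periodicMod_sqAddSqRel (h : ℤ) (p : ℕ) : PeriodicMod p (sqAddSqRel h p) :=
  periodicMod_zmod fun a b : ZMod p => a ^ 2 + b ^ 2 = (h : ZMod p)

lemma periodicMod_shiftRel (h p : ℕ) : PeriodicMod p (shiftRel h p) :=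
  periodicMod_zmod fun a _ : ZMod p => a = 0 ∨ a = -(h : ZMod p)

lemma residueCount_sqAddSqRel {h : ℤ} {p : ℕ} (hp : p.Prime) (hp4 : p % 4 = 3)
    (hph : ¬ (p : ℤ) ∣ h) : residueCount p (sqAddSqRel h p) = p + 1 := by
  have := Fact.mk hp
  rw [← card_sq_add_sq_eq hp4 (c := (h : ZMod p))
    (by rwa [Ne, ZMod.intCast_zmod_eq_zero_iff_dvd])]
  exact (residueCount_eq_card_zmod fun a b : ZMod p => a ^ 2 + b ^ 2 = (h : ZMod p)).trans
    (by congr)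

lemma residueCount_shiftRel {h p : ℕ} (hp : p.Prime) (hph : ¬ p ∣ h) :
    residueCount p (shiftRel h p) = 2 * p := by
  have := Fact.mk hp
  refine (residueCount_eq_card_zmod fun a _ : ZMod p => a = 0 ∨ a = -(h : ZMod p)).trans ?_
  have hset : ({z : ZMod p × ZMod p | z.1 = 0 ∨ z.1 = -(h : ZMod p)} : Finset _) =
      {0, -(h : ZMod p)} ×ˢ univ := by
    ext z
    simp
  have hne : (0 : ZMod p) ≠ -(h : ZMod p) := by
    rw [Ne, zero_eq_neg, ZMod.natCast_eq_zero_iff]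
    exact hph
  convert congrArg card hset using 1
  · congr
  · rw [card_product, card_pair hne, card_univ, ZMod.card]

end LocalCounts

section SieveAsymptotics

open Finset
open scoped Classical

/-- The primes `3` modulo `4` between `exp (L ^ δ)` and `exp (L ^ (1 - δ))`, where `L = log x`. -/
def siftPrimes (δ : ℝ) (x : ℕ) : Finset ℕ :=
  {p ∈ Ioc ⌊Real.exp (Real.log x ^ δ)⌋₊ ⌊Real.exp (Real.log x ^ (1 - δ))⌋₊ |
    p.Prime ∧ p % 4 = 3}

lemma tendsto_log_natCast_atTop : Tendsto (fun x : ℕ => Real.log x) atTop atTop :=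
  Real.tendsto_log_atTop.comp tendsto_natCast_atTop_atTop

lemma abs_log_log_floor_exp_sub_le {t : ℝ} (ht : 2 ≤ t) :
    2 ≤ ⌊Real.exp t⌋₊ ∧ |Real.log (Real.log ⌊Real.exp t⌋₊) - Real.log t| ≤ Real.log 2 := by
  have he2 : (2 : ℝ) ≤ Real.exp 1 := by have := Real.exp_one_gt_d9; linarith
  have h2 : (2 : ℝ) ≤ Real.exp t := he2.trans (Real.exp_le_exp.2 (by linarith))
  have hfl : Real.exp (t - 1) ≤ ⌊Real.exp t⌋₊ := by
    have h3 := Nat.lt_floor_add_one (Real.exp t)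
    have h4 : Real.exp t = Real.exp (t - 1) * Real.exp 1 := by rw [← Real.exp_add]; ring_nf
    have h5 : Real.exp 1 ≤ Real.exp (t - 1) := Real.exp_le_exp.2 (by linarith)
    nlinarith
  have hfl' : (⌊Real.exp t⌋₊ : ℝ) ≤ Real.exp t := Nat.floor_le (Real.exp_pos _).le
  have h2' : 2 ≤ ⌊Real.exp t⌋₊ := Nat.le_floor (by exact_mod_cast h2)
  have hpos : (0 : ℝ) < ⌊Real.exp t⌋₊ := by exact_mod_cast (by lia : 0 < ⌊Real.exp t⌋₊)
  have h6 : t - 1 ≤ Real.log ⌊Real.exp t⌋₊ := by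
    rw [← Real.log_exp (t - 1)]; exact Real.log_le_log (Real.exp_pos _) hfl
  have h7 : Real.log ⌊Real.exp t⌋₊ ≤ t :=
    (Real.log_le_iff_le_exp hpos).2 hfl'
  refine ⟨h2', abs_le.2 ⟨?_, ?_⟩⟩
  · have h8 : Real.log (t / 2) ≤ Real.log (Real.log ⌊Real.exp t⌋₊) :=
      Real.log_le_log (by linarith) (by linarith)
    rw [Real.log_div (by linarith) (by norm_num)] at h8
    linarith
  · have h8 : Real.log (Real.log ⌊Real.exp t⌋₊) ≤ Real.log t :=
      Real.log_le_log (by linarith) h7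
    have := Real.log_nonneg (by norm_num : (1 : ℝ) ≤ 2)
    linarith

lemma abs_sum_siftPrimes_sub_le {δ : ℝ} (hδ : 0 < δ) (hδ' : δ < 1 / 2) :
    ∃ C : ℝ, 0 ≤ C ∧ ∀ᶠ x : ℕ in atTop,
      |∑ p ∈ siftPrimes δ x, 1 / (p : ℝ) - (1 - 2 * δ) / 2 * Real.log (Real.log x)| ≤ C := by
  obtain ⟨C, hC, h⟩ := abs_sum_inv_mod_four_sub_le 3 (Or.inr rfl)
  refine ⟨2 * C + Real.log 2, by positivity, ?_⟩
  have hL := tendsto_log_natCast_atTop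
  filter_upwards [((tendsto_rpow_atTop hδ).comp hL).eventually_ge_atTop 2,
    ((tendsto_rpow_atTop (by linarith : 0 < 1 - δ)).comp hL).eventually_ge_atTop 2,
    hL.eventually_ge_atTop 1] with x h1 h2 h3
  simp only [Function.comp] at h1 h2
  obtain ⟨hY2, hY⟩ := abs_log_log_floor_exp_sub_le h1
  obtain ⟨hZ2, hZ⟩ := abs_log_log_floor_exp_sub_le h2
  have hYZ : ⌊Real.exp (Real.log x ^ δ)⌋₊ ≤ ⌊Real.exp (Real.log x ^ (1 - δ))⌋₊ :=
    Nat.floor_mono (Real.exp_le_exp.2 (Real.rpow_le_rpow_of_exponent_le h3 (by linarith)))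
  rw [siftPrimes]
  set Y := ⌊Real.exp (Real.log x ^ δ)⌋₊
  set Z := ⌊Real.exp (Real.log x ^ (1 - δ))⌋₊
  rw [Real.log_rpow (by linarith)] at hY hZ
  have h4 := abs_le.1 (h Y hY2)
  have h5 := abs_le.1 (h Z hZ2)
  have h6 : ∑ p ∈ Ioc 0 Z with (p.Prime ∧ p % 4 = 3), 1 / (p : ℝ) =
      ∑ p ∈ Ioc 0 Y with (p.Prime ∧ p % 4 = 3), 1 / (p : ℝ) +
      ∑ p ∈ Ioc Y Z with (p.Prime ∧ p % 4 = 3), 1 / (p : ℝ) := by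
    simp only [sum_filter]
    rw [sum_Ioc_consecutive _ (Nat.zero_le Y) hYZ]
  rw [abs_le] at hY hZ ⊢
  constructor <;> nlinarith

/-- Eventually the sieve parameters are admissible. -/
lemma eventually_sieve_parameters {δ : ℝ} (hδ : 0 < δ) :
    ∀ᶠ x : ℕ in atTop, 1 ≤ Real.log x ∧
      (⌊Real.exp (Real.log x ^ (1 - δ))⌋₊ : ℝ) ^ (2 * ⌈10 * Real.log (Real.log x)⌉₊) ≤
        (x : ℝ) ^ (1 / 8 : ℝ) ∧ Real.log x ≤ (x : ℝ) ^ (1 / 4 : ℝ) := by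
  have hL := tendsto_log_natCast_atTop
  have h1 : ∀ᶠ L : ℝ in atTop, Real.log L ≤ 1 / 320 * L ^ δ := by
    have := (isLittleO_log_rpow_atTop hδ).bound (by norm_num : (0 : ℝ) < 1 / 320)
    filter_upwards [this, eventually_ge_atTop 1] with L hL hL1
    rw [Real.norm_of_nonneg (Real.log_nonneg hL1), Real.norm_of_nonneg (by positivity)] at hL
    exact hL
  have h2 : ∀ᶠ t : ℝ in atTop, Real.log t ≤ t ^ (1 / 4 : ℝ) := by
    have := (isLittleO_log_rpow_atTop (by norm_num : (0 : ℝ) < 1 / 4)).bound one_pos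
    filter_upwards [this, eventually_ge_atTop 1] with t ht ht1
    rw [Real.norm_of_nonneg (Real.log_nonneg ht1), Real.norm_of_nonneg (by positivity),
      one_mul] at ht
    exact ht
  filter_upwards [hL.eventually h1, hL.eventually_ge_atTop 1,
    ((tendsto_rpow_atTop hδ).comp hL).eventually_ge_atTop 32,
    tendsto_natCast_atTop_atTop.eventually h2, eventually_ge_atTop 1] with x h3 h4 h5 h6 h7
  refine ⟨h4, ?_, h6⟩
  simp only [Function.comp] at h5
  have hx0 : (0 : ℝ) < x := by exact_mod_cast h7
  set L := Real.log x with hLdef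
  have hlog : 0 ≤ Real.log L := Real.log_nonneg h4
  set r := 2 * ⌈10 * Real.log L⌉₊ with hr
  have hrle : (r : ℝ) ≤ L ^ δ / 8 := by
    have := Nat.ceil_lt_add_one (by positivity : 0 ≤ 10 * Real.log L)
    rw [hr]
    push_cast
    linarith
  have hfl : (⌊Real.exp (L ^ (1 - δ))⌋₊ : ℝ) ≤ Real.exp (L ^ (1 - δ)) :=
    Nat.floor_le (Real.exp_pos _).le
  calc (⌊Real.exp (L ^ (1 - δ))⌋₊ : ℝ) ^ r ≤ Real.exp (L ^ (1 - δ)) ^ r := by gcongr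
    _ = Real.exp (r * L ^ (1 - δ)) := by rw [← Real.exp_nat_mul]
    _ ≤ Real.exp (L ^ δ / 8 * L ^ (1 - δ)) := by gcongr
    _ = Real.exp (L * (1 / 8)) := by
      congr 1
      rw [div_mul_eq_mul_div, ← Real.rpow_add (by linarith)]
      simp
      ring
    _ = (x : ℝ) ^ (1 / 8 : ℝ) := by rw [Real.rpow_def_of_pos hx0]

/-- The sieve bound with explicit powers of `log x`. -/
lemma residueCount_siftPrimes_le {δ κ : ℝ} (hδ : 0 < δ) (hδ' : δ < 1 / 2) (hκ : 0 ≤ κ)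
    (hκ' : κ ≤ 2) :
    ∃ C : ℝ, 0 < C ∧ ∀ᶠ x : ℕ in atTop, ∀ N : ℕ, x ≤ N ^ 2 → ∀ E : ℕ → ℕ → ℕ → Prop,
      (∀ p ∈ siftPrimes δ x, PeriodicMod p (E p) ∧ κ * p ≤ residueCount p (E p) ∧
        residueCount p (E p) ≤ 2 * p) →
      (residueCount N (fun a b => ∀ p ∈ siftPrimes δ x, ¬ E p a b) : ℝ) ≤
        C * (N : ℝ) ^ 2 * Real.log x ^ (-(κ * (1 - 2 * δ) / 2)) := by
  obtain ⟨C₀, hC₀, hsum⟩ := abs_sum_siftPrimes_sub_le hδ hδ'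
  refine ⟨Real.exp (2 * C₀) + Real.exp (6 * C₀) + 3, by positivity, ?_⟩
  filter_upwards [hsum, eventually_sieve_parameters hδ, eventually_ge_atTop 1]
    with x hs hpar hx1 N hN E hE
  obtain ⟨hL1, hZr, hLx⟩ := hpar
  have hx0 : (1 : ℝ) ≤ x := by exact_mod_cast hx1
  have hNR : (x : ℝ) ≤ (N : ℝ) ^ 2 := by exact_mod_cast hN
  have hN0 : (0 : ℝ) ≤ N := Nat.cast_nonneg _
  set L := Real.log x with hL
  set P := siftPrimes δ x with hP
  set r := 2 * ⌈10 * Real.log L⌉₊ with hr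
  set Z := ⌊Real.exp (L ^ (1 - δ))⌋₊ with hZ
  have hxN : (x : ℝ) ^ (1 / 2 : ℝ) ≤ N := by
    rw [← Real.sqrt_eq_rpow]
    exact (Real.sqrt_le_left hN0).2 hNR
  have hlog : 0 ≤ Real.log L := Real.log_nonneg hL1
  have hZrN : Z ^ r ≤ N := by
    have : (Z : ℝ) ^ r ≤ N :=
      hZr.trans ((Real.rpow_le_rpow_of_exponent_le hx0 (by norm_num)).trans hxN)
    exact_mod_cast this
  have hPZ : ∀ p ∈ P, p.Prime ∧ p ≤ Z := by
    intro p hp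
    simp only [hP, siftPrimes, mem_filter, mem_Ioc] at hp
    exact ⟨hp.2.1, hp.1.2⟩
  have key := residueCount_sifted_le (even_two_mul _ : Even r) hZrN hPZ fun p hp => (hE p hp).1
  set S := ∑ p ∈ P, (residueCount p (E p) / p ^ 2 : ℝ) with hS
  have hSlow : κ * ∑ p ∈ P, 1 / (p : ℝ) ≤ S := by
    rw [mul_sum]
    refine sum_le_sum fun p hp => ?_
    have hp0 : (0 : ℝ) < p := by exact_mod_cast (hPZ p hp).1.pos
    rw [le_div_iff₀ (by positivity)]
    calc κ * (1 / p) * (p : ℝ) ^ 2 = κ * p := by field_simp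
      _ ≤ _ := (hE p hp).2.1
  have hShigh : S ≤ 2 * ∑ p ∈ P, 1 / (p : ℝ) := by
    rw [mul_sum]
    refine sum_le_sum fun p hp => ?_
    have hp0 : (0 : ℝ) < p := by exact_mod_cast (hPZ p hp).1.pos
    rw [div_le_iff₀ (by positivity)]
    calc (residueCount p (E p) : ℝ) ≤ 2 * p := by exact_mod_cast (hE p hp).2.2
      _ = 2 * (1 / p) * (p : ℝ) ^ 2 := by field_simp
  rw [abs_le] at hs
  set e := κ * (1 - 2 * δ) / 2 with he
  have he1 : e ≤ 1 := by rw [he]; nlinarith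
  have hpow : ∀ s : ℝ, Real.exp (s * Real.log L) = L ^ s := by
    intro s
    rw [Real.rpow_def_of_pos (by linarith), mul_comm]
  have h1 : Real.exp (-S) ≤ Real.exp (2 * C₀) * L ^ (-e) := by
    rw [← hpow, ← Real.exp_add]
    refine Real.exp_le_exp.2 ?_
    have : κ * ((1 - 2 * δ) / 2 * Real.log L - C₀) ≤ S :=
      (mul_le_mul_of_nonneg_left (by linarith) hκ).trans hSlow
    have h2 : κ * C₀ ≤ 2 * C₀ := by gcongr
    rw [he]
    linarith
  have h2 : Real.exp (-r + 3 * S) ≤ Real.exp (6 * C₀) * L ^ (-e) := by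
    rw [← hpow, ← Real.exp_add]
    refine Real.exp_le_exp.2 ?_
    have h3 : 20 * Real.log L ≤ r := by
      have := Nat.le_ceil (10 * Real.log L)
      rw [hr]
      push_cast
      linarith
    have h4 : e * Real.log L ≤ 1 * Real.log L := by gcongr
    have h5 : S ≤ Real.log L + 2 * C₀ := by nlinarith
    linarith
  have h3 : 3 * (N : ℝ) * Z ^ (2 * r) ≤ 3 * (N : ℝ) ^ 2 * L ^ (-e) := by
    have h4 : (Z : ℝ) ^ (2 * r) ≤ (x : ℝ) ^ (1 / 4 : ℝ) := by
      calc (Z : ℝ) ^ (2 * r) = (Z : ℝ) ^ r * (Z : ℝ) ^ r := by ring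
        _ ≤ (x : ℝ) ^ (1 / 8 : ℝ) * (x : ℝ) ^ (1 / 8 : ℝ) := by gcongr
        _ = (x : ℝ) ^ (1 / 4 : ℝ) := by rw [← Real.rpow_add (by linarith)]; norm_num
    have h5 : 1 ≤ (x : ℝ) ^ (1 / 4 : ℝ) * L ^ (-e) := by
      have h6 : L ^ e ≤ (x : ℝ) ^ (1 / 4 : ℝ) :=
        (Real.rpow_le_rpow_of_exponent_le hL1 he1).trans (by rwa [Real.rpow_one])
      rw [Real.rpow_neg (by linarith), ← div_eq_mul_inv, le_div_iff₀ (by positivity), one_mul]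
      exact h6
    calc 3 * (N : ℝ) * Z ^ (2 * r) ≤ 3 * (N : ℝ) * (x : ℝ) ^ (1 / 4 : ℝ) := by gcongr
      _ ≤ 3 * (N : ℝ) * (x : ℝ) ^ (1 / 4 : ℝ) * ((x : ℝ) ^ (1 / 4 : ℝ) * L ^ (-e)) :=
        le_mul_of_one_le_right (by positivity) h5
      _ = 3 * (N : ℝ) * (x : ℝ) ^ (1 / 2 : ℝ) * L ^ (-e) := by
        have : (x : ℝ) ^ (1 / 2 : ℝ) = (x : ℝ) ^ (1 / 4 : ℝ) * (x : ℝ) ^ (1 / 4 : ℝ) := by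
          rw [← Real.rpow_add (by linarith)]; norm_num
        rw [this]
        ring
      _ ≤ 3 * (N : ℝ) * N * L ^ (-e) := by gcongr
      _ = 3 * (N : ℝ) ^ 2 * L ^ (-e) := by ring
  calc _ ≤ _ := key
    _ ≤ (N : ℝ) ^ 2 * (Real.exp (2 * C₀) * L ^ (-e) + Real.exp (6 * C₀) * L ^ (-e)) +
        3 * (N : ℝ) ^ 2 * L ^ (-e) := by gcongr
    _ = _ := by ring

end SieveAsymptotics

section Applications

open Finset
open scoped Classical

lemma r2_le_card {n N : ℕ} (h : n < N ^ 2) :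
    r2 n ≤ 4 * #{z ∈ range N ×ˢ range N | z.1 ^ 2 + z.2 ^ 2 = n} := by
  set T := {z ∈ range N ×ˢ range N | z.1 ^ 2 + z.2 ^ 2 = n} with hT
  have hmem : ∀ p : {p : ℤ × ℤ // p.1 ^ 2 + p.2 ^ 2 = (n : ℤ)},
      (p.1.1.natAbs, p.1.2.natAbs) ∈ T := by
    rintro ⟨⟨a, b⟩, hab⟩
    have h1 : a.natAbs ^ 2 + b.natAbs ^ 2 = n := by zify; simpa using hab
    simp only [hT, mem_filter, mem_product, mem_range]
    exact ⟨⟨lt_of_pow_lt_pow_left₀ 2 (Nat.zero_le _) (by lia),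
      lt_of_pow_lt_pow_left₀ 2 (Nat.zero_le _) (by lia)⟩, h1⟩
  have hle := Nat.card_le_card_of_injective
    (fun p : {p : ℤ × ℤ // p.1 ^ 2 + p.2 ^ 2 = (n : ℤ)} =>
      (((⟨_, hmem p⟩ : T), decide (0 ≤ p.1.1), decide (0 ≤ p.1.2)) : T × Bool × Bool)) (by
      rintro ⟨⟨a, b⟩, hab⟩ ⟨⟨a', b'⟩, hab'⟩ heq
      simp only [Prod.mk.injEq, Subtype.mk.injEq, decide_eq_decide] at heq ⊢
      lia)
  rw [r2]
  refine hle.trans (le_of_eq ?_)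
  rw [Nat.card_prod, Nat.card_prod, Nat.card_eq_fintype_card, Fintype.card_coe]
  simp
  ring

lemma sum_r2_le_card (A : Finset ℕ) {N : ℕ} (hA : ∀ n ∈ A, n < N ^ 2) :
    ∑ n ∈ A, r2 n ≤ 4 * #{z ∈ range N ×ˢ range N | z.1 ^ 2 + z.2 ^ 2 ∈ A} := by
  calc ∑ n ∈ A, r2 n ≤ ∑ n ∈ A, 4 * #{z ∈ range N ×ˢ range N | z.1 ^ 2 + z.2 ^ 2 = n} :=
        sum_le_sum fun n hn => r2_le_card (hA n hn)
    _ = 4 * #{z ∈ range N ×ˢ range N | z.1 ^ 2 + z.2 ^ 2 ∈ A} := by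
        rw [← mul_sum, card_eq_sum_card_fiberwise (t := A) (f := fun z => z.1 ^ 2 + z.2 ^ 2)
          (fun z hz => by simpa using (mem_filter.1 (mem_coe.1 hz)).2)]
        congr 1
        refine sum_congr rfl fun n hn => ?_
        rw [filter_filter]
        congr 1
        ext z
        simp only [mem_filter]
        constructor
        · rintro ⟨h1, h2⟩; exact ⟨h1, h2 ▸ hn, h2⟩
        · rintro ⟨h1, -, h2⟩; exact ⟨h1, h2⟩

lemma sqrt_succ_sq_bounds (x : ℕ) (hx : 1 ≤ x) :
    2 * x < (Nat.sqrt (2 * x) + 1) ^ 2 ∧ (Nat.sqrt (2 * x) + 1) ^ 2 ≤ 8 * x := by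
  have h1 := Nat.lt_succ_sqrt (2 * x)
  have h2 := Nat.sqrt_le (2 * x)
  have h3 : 1 ≤ Nat.sqrt (2 * x) := Nat.le_sqrt.2 (by lia)
  simp only [Nat.succ_eq_add_one] at h1
  constructor <;> nlinarith

lemma sum_range_r2_le (x : ℕ) (hx : 1 ≤ x) : ∑ n ∈ range (2 * x + 1), r2 n ≤ 32 * x := by
  obtain ⟨h1, h2⟩ := sqrt_succ_sq_bounds x hx
  set N := Nat.sqrt (2 * x) + 1
  have h3 := sum_r2_le_card (range (2 * x + 1)) (N := N) fun n hn => by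
    rw [mem_range] at hn
    lia
  have h4 := card_filter_le (range N ×ˢ range N) (fun z => z.1 ^ 2 + z.2 ^ 2 ∈ range (2 * x + 1))
  rw [card_product, card_range, ← sq] at h4
  lia

lemma r2_le_sqrt {n : ℕ} (hn : 1 ≤ n) : (r2 n : ℝ) ≤ 8 * √n := by
  set N := Nat.sqrt n + 1 with hN
  have h1 : n < N ^ 2 := by rw [sq]; exact Nat.lt_succ_sqrt n
  have h2 : #{z ∈ range N ×ˢ range N | z.1 ^ 2 + z.2 ^ 2 = n} ≤ #(range N) := by
    refine card_le_card_of_injOn Prod.fst ?_ ?_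
    · intro z hz
      simp only [coe_filter, mem_product, mem_range, Set.mem_ofPred_eq, coe_range,
        Set.mem_Iio] at hz ⊢
      exact hz.1.1
    · rintro ⟨a, b⟩ hz ⟨a', b'⟩ hz' heq
      simp only [coe_filter, mem_product, mem_range, Set.mem_ofPred_eq] at hz hz' heq
      subst heq
      have : b ^ 2 = b' ^ 2 := by lia
      rw [Nat.pow_left_injective two_ne_zero this]
  have h3 : r2 n ≤ 4 * N := by
    rw [card_range] at h2
    exact (r2_le_card h1).trans (by lia)
  have h4 : ((Nat.sqrt n : ℕ) : ℝ) ≤ √n := Real.nat_sqrt_le_real_sqrt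
  have h5 : 1 ≤ √(n : ℝ) := Real.one_le_sqrt.2 (by exact_mod_cast hn)
  have h6 : (r2 n : ℝ) ≤ 4 * (Nat.sqrt n + 1) := by exact_mod_cast h3
  linarith

lemma r2_eq_zero_of_notMem {n : ℕ} (h : n ∉ SOS) : r2 n = 0 := by
  have : IsEmpty {p : ℤ × ℤ // p.1 ^ 2 + p.2 ^ 2 = (n : ℤ)} :=
    ⟨fun p => h ⟨p.1.1, p.1.2, p.2.symm⟩⟩
  exact Nat.card_of_isEmpty

/-- The integers up to `x` without a prime factor in `siftPrimes δ x`. -/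
def unsifted (δ : ℝ) (x : ℕ) : Finset ℕ := {m ∈ range (x + 1) | ∀ p ∈ siftPrimes δ x, ¬ p ∣ m}

/-- The integers up to `2 x` of the form `m + h` with `m` unsifted. -/
def shiftUnsifted (δ : ℝ) (x : ℕ) (h : ℤ) : Finset ℕ :=
  {n ∈ range (2 * x + 1) | ∃ m ∈ unsifted δ x, (n : ℤ) = m + h}

/-- The integers `a` up to `x` such that neither `a` nor `a + d` has a factor in
`siftPrimes δ x`. -/
def unsiftedPairs (δ : ℝ) (x d : ℕ) : Finset ℕ :=
  {a ∈ range (x + 1) | ∀ p ∈ siftPrimes δ x, ¬ p ∣ a ∧ ¬ p ∣ a + d}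

/-- The positive integers up to `2 x` divisible by the square of a prime in `siftPrimes δ x`. -/
def sqDivisible (δ : ℝ) (x : ℕ) : Finset ℕ :=
  {n ∈ Icc 1 (2 * x) | ∃ p ∈ siftPrimes δ x, p ^ 2 ∣ n}

lemma prime_of_mem_siftPrimes {δ : ℝ} {x p : ℕ} (h : p ∈ siftPrimes δ x) :
    p.Prime ∧ p % 4 = 3 := (mem_filter.1 h).2

lemma floor_lt_of_mem_siftPrimes {δ : ℝ} {x p : ℕ} (h : p ∈ siftPrimes δ x) :
    ⌊Real.exp (Real.log x ^ δ)⌋₊ < p := (mem_Ioc.1 (mem_filter.1 h).1).1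

lemma sq_dvd_of_mem_SOS {n p : ℕ} (hn : n ∈ SOS) (hp : p.Prime) (hp4 : p % 4 = 3) (h : p ∣ n) :
    p ^ 2 ∣ n := by
  rcases Nat.eq_zero_or_pos n with rfl | hn0
  · simp
  rw [mem_SOS_iff_nat, Nat.eq_sq_add_sq_iff] at hn
  have hmem : p ∈ n.primeFactors := Nat.mem_primeFactors.2 ⟨hp, h, hn0.ne'⟩
  have heven := hn p hmem hp4
  have := Fact.mk hp
  rw [padicValNat_dvd_iff_le hn0.ne']
  have h1 : 1 ≤ padicValNat p n := one_le_padicValNat_of_dvd hn0.ne' h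
  obtain ⟨k, hk⟩ := heven
  lia

/-- A sum of two squares is either unsifted or divisible by the square of a sifting prime. -/
lemma not_dvd_of_mem_SOS {δ : ℝ} {x n : ℕ} (hn : n ∈ SOS) (hn0 : 1 ≤ n) (hnx : n ≤ 2 * x)
    (h : n ∉ sqDivisible δ x) : ∀ p ∈ siftPrimes δ x, ¬ p ∣ n := by
  intro p hp hpn
  obtain ⟨h1, h2⟩ := prime_of_mem_siftPrimes hp
  exact h (mem_filter.2 ⟨mem_Icc.2 ⟨hn0, hnx⟩, p, hp, sq_dvd_of_mem_SOS hn h1 h2 hpn⟩)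

lemma card_sqDivisible_le (δ : ℝ) (x : ℕ) :
    (#(sqDivisible δ x) : ℝ) ≤ 4 * x * Real.exp (-Real.log x ^ δ) := by
  set t := Real.log x ^ δ with ht
  set Y := ⌊Real.exp t⌋₊ with hY
  set Z := ⌊Real.exp (Real.log x ^ (1 - δ))⌋₊ with hZ
  have h1 : #(sqDivisible δ x) ≤ ∑ p ∈ siftPrimes δ x, 2 * x / p ^ 2 := by
    have hsub : sqDivisible δ x ⊆
        (siftPrimes δ x).biUnion fun p => {n ∈ Ioc 0 (2 * x) | p ^ 2 ∣ n} := by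
      intro n hn
      simp only [sqDivisible, mem_filter, mem_Icc, mem_biUnion, mem_Ioc] at hn ⊢
      obtain ⟨hn1, p, hp, hpn⟩ := hn
      exact ⟨p, hp, ⟨by lia, by lia⟩, hpn⟩
    refine (card_le_card hsub).trans (card_biUnion_le.trans (sum_le_sum fun p _ => ?_))
    rw [Nat.Ioc_filter_dvd_card_eq_div]
  have h2 : (∑ p ∈ siftPrimes δ x, ((p : ℝ) ^ 2)⁻¹) ≤ 2 / (Y + 1) := by
    refine le_trans ?_ (sum_Ioo_inv_sq_le (α := ℝ) Y (Z + 1))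
    refine sum_le_sum_of_subset_of_nonneg ?_ fun _ _ _ => by positivity
    intro p hp
    have := mem_Ioc.1 (mem_filter.1 hp).1
    rw [mem_Ioo]
    exact ⟨this.1, by lia⟩
  have h3 : Real.exp t ≤ Y + 1 := (Nat.lt_floor_add_one _).le
  calc (#(sqDivisible δ x) : ℝ) ≤ ∑ p ∈ siftPrimes δ x, ((2 * x / p ^ 2 : ℕ) : ℝ) := by
        exact_mod_cast h1
    _ ≤ ∑ p ∈ siftPrimes δ x, 2 * (x : ℝ) * ((p : ℝ) ^ 2)⁻¹ := by
        refine sum_le_sum fun p _ => ?_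
        refine Nat.cast_div_le.trans (le_of_eq ?_)
        push_cast
        rw [div_eq_mul_inv]
    _ = 2 * x * ∑ p ∈ siftPrimes δ x, ((p : ℝ) ^ 2)⁻¹ := (mul_sum _ _ _).symm
    _ ≤ 2 * x * (2 / Real.exp t) := by
        refine mul_le_mul_of_nonneg_left (h2.trans ?_) (by positivity)
        gcongr
    _ = 4 * x * Real.exp (-t) := by rw [Real.exp_neg]; ring

lemma eventually_sq_log_lt_floor {δ : ℝ} (hδ : 0 < δ) :
    ∀ᶠ x : ℕ in atTop, Real.log x ^ 4 ≤ Real.exp (Real.log x ^ δ) ∧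
      ∀ p ∈ siftPrimes δ x, Real.log x ^ 2 < p := by
  have h1 : ∀ᶠ L : ℝ in atTop, L ^ 4 ≤ Real.exp (L ^ δ) := by
    have h2 := (isLittleO_log_rpow_atTop hδ).bound (by norm_num : (0 : ℝ) < 1 / 4)
    filter_upwards [h2, eventually_ge_atTop 1] with L hL hL1
    rw [Real.norm_of_nonneg (Real.log_nonneg hL1), Real.norm_of_nonneg (by positivity)] at hL
    rw [← Real.exp_log (by positivity : 0 < L ^ 4), Real.log_pow]
    refine Real.exp_le_exp.2 ?_
    push_cast
    linarith
  filter_upwards [tendsto_log_natCast_atTop.eventually h1,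
    tendsto_log_natCast_atTop.eventually_ge_atTop 2] with x hx hx2
  refine ⟨hx, fun p hp => ?_⟩
  have h3 := floor_lt_of_mem_siftPrimes hp
  have h4 : Real.exp (Real.log x ^ δ) < p := (Nat.floor_lt (Real.exp_pos _).le).1 h3
  have h5 : Real.log x ^ 2 ≤ Real.log x ^ 4 := pow_le_pow_right₀ (by linarith) (by norm_num)
  linarith

/-- On average, `r₂` is small at a fixed nonzero distance from unsifted integers. -/
lemma sum_r2_shift_unsifted_le {δ : ℝ} (hδ : 0 < δ) (hδ' : δ < 1 / 2) :
    ∃ C : ℝ, 0 < C ∧ ∀ᶠ x : ℕ in atTop, ∀ h : ℤ, h ≠ 0 → (h.natAbs : ℝ) ≤ Real.log x ^ 2 →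
      ∑ n ∈ shiftUnsifted δ x h, (r2 n : ℝ) ≤
        C * x * Real.log x ^ (-(1 / 2 - δ)) := by
  obtain ⟨C, hC, hev⟩ := residueCount_siftPrimes_le hδ hδ' zero_le_one one_le_two
  refine ⟨32 * C, by positivity, ?_⟩
  filter_upwards [hev, eventually_sq_log_lt_floor hδ, eventually_ge_atTop 1]
    with x hx hL hx1 h hh0 hh
  obtain ⟨h1, h2⟩ := sqrt_succ_sq_bounds x hx1
  set N := Nat.sqrt (2 * x) + 1
  have hsieve := hx N (by lia) (sqAddSqRel h) fun p hp => by
    obtain ⟨hp1, hp4⟩ := prime_of_mem_siftPrimes hp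
    have hdvd : ¬ (p : ℤ) ∣ h := by
      intro hd
      have h3 : p ≤ h.natAbs := Nat.le_of_dvd (Int.natAbs_pos.2 hh0) (Int.natCast_dvd.1 hd)
      have h4 : (p : ℝ) ≤ h.natAbs := by exact_mod_cast h3
      have := hL.2 p hp
      linarith
    rw [residueCount_sqAddSqRel hp1 hp4 hdvd]
    refine ⟨periodicMod_sqAddSqRel h p, by push_cast; linarith, ?_⟩
    have := hp1.one_lt
    lia
  have hsum := sum_r2_le_card (shiftUnsifted δ x h) (N := N) fun n hn => by
      have := mem_range.1 (mem_filter.1 hn).1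
      lia
  have hcard : #{z ∈ range N ×ˢ range N | z.1 ^ 2 + z.2 ^ 2 ∈ shiftUnsifted δ x h} ≤
      residueCount N fun a b => ∀ p ∈ siftPrimes δ x, ¬ sqAddSqRel h p a b := by
    refine card_le_card fun z hz => ?_
    simp only [mem_filter, shiftUnsifted, unsifted] at hz ⊢
    obtain ⟨hz1, -, m, ⟨-, hm⟩, hzm⟩ := hz
    refine ⟨hz1, fun p hp hrel => hm p hp ?_⟩
    rw [sqAddSqRel] at hrel
    have hcast := congrArg (Int.cast : ℤ → ZMod p) hzm
    push_cast at hcast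
    rw [hrel, right_eq_add] at hcast
    exact (ZMod.natCast_eq_zero_iff _ _).1 hcast
  have hN : (N : ℝ) ^ 2 ≤ 8 * x := by exact_mod_cast h2
  have hexp : -(1 * (1 - 2 * δ) / 2) = -(1 / 2 - δ) := by ring
  rw [hexp] at hsieve
  have hlog : 0 ≤ Real.log x := Real.log_natCast_nonneg x
  calc ∑ n ∈ shiftUnsifted δ x h, (r2 n : ℝ)
      ≤ 4 * (residueCount N fun a b => ∀ p ∈ siftPrimes δ x, ¬ sqAddSqRel h p a b : ℕ) := by
        exact_mod_cast hsum.trans (Nat.mul_le_mul_left 4 hcard)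
    _ ≤ 4 * (C * (N : ℝ) ^ 2 * Real.log x ^ (-(1 / 2 - δ))) := by linarith
    _ ≤ 4 * (C * (8 * x) * Real.log x ^ (-(1 / 2 - δ))) := by gcongr
    _ = 32 * C * x * Real.log x ^ (-(1 / 2 - δ)) := by ring

/-- Pairs of unsifted integers at a fixed distance are rare. -/
lemma card_unsifted_pairs_le {δ : ℝ} (hδ : 0 < δ) (hδ' : δ < 1 / 2) :
    ∃ C : ℝ, 0 < C ∧ ∀ᶠ x : ℕ in atTop, ∀ d : ℕ, 1 ≤ d → (d : ℝ) ≤ Real.log x ^ 2 →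
      (#(unsiftedPairs δ x d) : ℝ) ≤
        C * x * Real.log x ^ (-(1 - 2 * δ)) := by
  obtain ⟨C, hC, hev⟩ := residueCount_siftPrimes_le hδ hδ' zero_le_two le_rfl
  refine ⟨2 * C, by positivity, ?_⟩
  filter_upwards [hev, eventually_sq_log_lt_floor hδ, eventually_ge_atTop 1]
    with x hx hL hx1 d hd1 hd
  have hsieve := hx (x + 1) (by nlinarith) (shiftRel d) fun p hp => by
    obtain ⟨hp1, -⟩ := prime_of_mem_siftPrimes hp
    have hdvd : ¬ p ∣ d := by
      intro hpd
      have h4 : (p : ℝ) ≤ d := by exact_mod_cast Nat.le_of_dvd hd1 hpd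
      have := hL.2 p hp
      linarith
    rw [residueCount_shiftRel hp1 hdvd]
    exact ⟨periodicMod_shiftRel d p, by push_cast; linarith, le_rfl⟩
  have hcard : #(unsiftedPairs δ x d) * (x + 1) ≤
      residueCount (x + 1) fun a b => ∀ p ∈ siftPrimes δ x, ¬ shiftRel d p a b := by
    nth_rewrite 1 [← card_range (x + 1)]
    rw [← card_product]
    refine card_le_card fun z hz => ?_
    simp only [unsiftedPairs, mem_filter, mem_product] at hz ⊢
    refine ⟨⟨hz.1.1, hz.2⟩, fun p hp hrel => ?_⟩
    obtain ⟨h1, h2⟩ := hz.1.2 p hp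
    rw [shiftRel, ZMod.natCast_eq_zero_iff, eq_neg_iff_add_eq_zero, ← Nat.cast_add,
      ZMod.natCast_eq_zero_iff] at hrel
    exact hrel.elim h1 h2
  have hexp : -(2 * (1 - 2 * δ) / 2) = -(1 - 2 * δ) := by ring
  rw [hexp] at hsieve
  have hlog : 0 ≤ Real.log x := Real.log_natCast_nonneg x
  have hx1' : (1 : ℝ) ≤ x := by exact_mod_cast hx1
  have hcard' : (#(unsiftedPairs δ x d) : ℝ) *
      (x + 1) ≤ C * (x + 1) * Real.log x ^ (-(1 - 2 * δ)) * (x + 1) := by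
    refine le_trans (by exact_mod_cast hcard) (hsieve.trans (le_of_eq ?_))
    push_cast
    ring
  refine (le_of_mul_le_mul_right hcard' (by positivity)).trans ?_
  have : C * (x + 1) ≤ 2 * C * x := by nlinarith
  gcongr

end Applications

section TailSums

open Finset
open scoped Classical

/-- The distance between two natural numbers. -/
def gap (m n : ℕ) : ℕ := ((n : ℤ) - m).natAbs

/-- The term `r₂(n) |m - n| ^ (-2q)`. -/
def tailTerm (q : ℝ) (m n : ℕ) : ℝ := (r2 n : ℝ) * (gap m n : ℝ) ^ (-(2 * q))

lemma tailTerm_nonneg (q : ℝ) (m n : ℕ) : 0 ≤ tailTerm q m n := by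
  unfold tailTerm
  positivity

lemma abs_natCast_sub_eq_gap (m n : ℕ) : |(m : ℝ) - n| = gap m n := by
  rw [gap, Nat.cast_natAbs, abs_sub_comm]
  push_cast
  rfl

lemma sum_shift_le (U V : Finset ℕ) (h : ℤ) :
    ∑ z ∈ U ×ˢ V with (z.2 : ℤ) - z.1 = h, (r2 z.2 : ℝ) ≤
      ∑ n ∈ ({n ∈ V | ∃ m ∈ U, (n : ℤ) = m + h} : Finset ℕ), (r2 n : ℝ) := by
  rw [← sum_image (g := fun z : ℕ × ℕ => z.2) (f := fun n => (r2 n : ℝ))]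
  · refine sum_le_sum_of_subset_of_nonneg ?_ fun _ _ _ => Nat.cast_nonneg _
    intro n hn
    simp only [mem_image, mem_filter, mem_product] at hn ⊢
    obtain ⟨z, ⟨⟨h1, h2⟩, h3⟩, rfl⟩ := hn
    exact ⟨h2, z.1, h1, by lia⟩
  · rintro ⟨a, b⟩ hz ⟨a', b'⟩ hz' heq
    simp only [coe_filter, Set.mem_ofPred_eq] at hz hz' heq
    have h1 := hz.2
    have h2 := hz'.2
    simp only [Prod.mk.injEq]
    lia

lemma sum_gap_eq_le (U V : Finset ℕ) (d : ℕ) :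
    ∑ z ∈ U ×ˢ V with gap z.1 z.2 = d, (r2 z.2 : ℝ) ≤
      ∑ n ∈ ({n ∈ V | ∃ m ∈ U, (n : ℤ) = m + d} : Finset ℕ), (r2 n : ℝ) +
      ∑ n ∈ ({n ∈ V | ∃ m ∈ U, (n : ℤ) = m + -d} : Finset ℕ), (r2 n : ℝ) := by
  refine le_trans ?_ (add_le_add (sum_shift_le U V d) (sum_shift_le U V (-d)))
  rw [sum_filter, sum_filter, sum_filter, ← sum_add_distrib]
  refine sum_le_sum fun z _ => ?_
  have hr : (0 : ℝ) ≤ r2 z.2 := Nat.cast_nonneg _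
  by_cases h : gap z.1 z.2 = d
  · rw [if_pos h]
    rcases Int.natAbs_eq_iff.1 h with h1 | h1
    · rw [if_pos h1]
      split_ifs <;> linarith
    · rw [if_pos h1]
      split_ifs <;> linarith
  · rw [if_neg h]
    split_ifs <;> linarith

lemma sum_tailTerm_le (q : ℝ) (U V I : Finset ℕ) {B : ℝ}
    (hB : ∀ d ∈ I, ∑ z ∈ U ×ˢ V with gap z.1 z.2 = d, (r2 z.2 : ℝ) ≤ B) :
    ∑ m ∈ U, ∑ n ∈ V with gap m n ∈ I, tailTerm q m n ≤
      B * ∑ d ∈ I, (d : ℝ) ^ (-(2 * q)) := by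
  calc ∑ m ∈ U, ∑ n ∈ V with gap m n ∈ I, tailTerm q m n
      = ∑ z ∈ U ×ˢ V with gap z.1 z.2 ∈ I, tailTerm q z.1 z.2 := by
        rw [sum_filter, sum_product]
        exact sum_congr rfl fun m _ => sum_filter _ _
    _ = ∑ d ∈ I, ∑ z ∈ U ×ˢ V with gap z.1 z.2 = d, tailTerm q z.1 z.2 := by
        rw [← sum_fiberwise_of_maps_to (t := I) (g := fun z : ℕ × ℕ => gap z.1 z.2)
          (fun z hz => (mem_filter.1 hz).2)]
        refine sum_congr rfl fun d hd => ?_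
        rw [filter_filter]
        refine sum_congr ?_ fun _ _ => rfl
        ext z
        simp only [mem_filter]
        constructor
        · rintro ⟨h1, -, h2⟩; exact ⟨h1, h2⟩
        · rintro ⟨h1, h2⟩; exact ⟨h1, h2 ▸ hd, h2⟩
    _ = ∑ d ∈ I, (∑ z ∈ U ×ˢ V with gap z.1 z.2 = d, (r2 z.2 : ℝ)) * (d : ℝ) ^ (-(2 * q)) := by
        refine sum_congr rfl fun d _ => ?_
        rw [sum_mul]
        refine sum_congr rfl fun z hz => ?_
        rw [tailTerm, (mem_filter.1 hz).2]
    _ ≤ ∑ d ∈ I, B * (d : ℝ) ^ (-(2 * q)) := by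
        refine sum_le_sum fun d hd => ?_
        gcongr
        exact hB d hd
    _ = B * ∑ d ∈ I, (d : ℝ) ^ (-(2 * q)) := (mul_sum _ _ _).symm

lemma sum_rpow_Ioc_floor_le {q H : ℝ} (hq : 1 < q) (hH : 1 ≤ H) (M : ℕ) :
    ∑ d ∈ Ioc ⌊H⌋₊ M, (d : ℝ) ^ (-(2 * q)) ≤ 2 * H ^ (1 - 2 * q) := by
  have hH0 : 0 < H := by linarith
  calc ∑ d ∈ Ioc ⌊H⌋₊ M, (d : ℝ) ^ (-(2 * q))
      ≤ ∑ d ∈ Ioc ⌊H⌋₊ M, H ^ (2 - 2 * q) * ((d : ℝ) ^ 2)⁻¹ := by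
        refine sum_le_sum fun d hd => ?_
        have hd1 : H < d := (Nat.floor_lt hH0.le).1 (mem_Ioc.1 hd).1
        have hd0 : (0 : ℝ) < d := by linarith
        have h1 : (d : ℝ) ^ (-(2 * q)) = (d : ℝ) ^ (2 - 2 * q) * ((d : ℝ) ^ 2)⁻¹ := by
          rw [← Real.rpow_natCast, ← Real.rpow_neg hd0.le, ← Real.rpow_add hd0]
          congr 1
          push_cast
          ring
        rw [h1]
        exact mul_le_mul_of_nonneg_right
          (Real.rpow_le_rpow_of_nonpos hH0 hd1.le (by linarith)) (by positivity)
    _ = H ^ (2 - 2 * q) * ∑ d ∈ Ioc ⌊H⌋₊ M, ((d : ℝ) ^ 2)⁻¹ := (mul_sum _ _ _).symm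
    _ ≤ H ^ (2 - 2 * q) * (2 / H) := by
        gcongr
        have hsub : Ioc ⌊H⌋₊ M ⊆ Ioo ⌊H⌋₊ (M + 1) := by
          intro d hd
          rw [mem_Ioc] at hd
          rw [mem_Ioo]
          lia
        refine (sum_le_sum_of_subset_of_nonneg hsub fun _ _ _ => by positivity).trans
          ((sum_Ioo_inv_sq_le (α := ℝ) _ _).trans ?_)
        gcongr
        exact (Nat.lt_floor_add_one H).le
    _ = 2 * H ^ (1 - 2 * q) := by
        rw [show 1 - 2 * q = 2 - 2 * q - 1 by ring, Real.rpow_sub_one hH0.ne']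
        ring

lemma card_filter_lt_le_div (U : Finset ℕ) (f : ℕ → ℝ) (hf : ∀ m, 0 ≤ f m) {T B : ℝ} (hT : 0 < T)
    (hB : ∑ m ∈ U, f m ≤ B) : (#{m ∈ U | T < f m} : ℝ) ≤ B / T := by
  rw [le_div_iff₀ hT, ← nsmul_eq_mul]
  refine le_trans ?_ hB
  refine le_trans (card_nsmul_le_sum _ f T fun m hm => (mem_filter.1 hm).2.le) ?_
  exact sum_le_sum_of_subset_of_nonneg (filter_subset _ _) fun m _ _ => hf m

lemma sum_tailTerm_far_le {q : ℝ} (hq : 1 < q) :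
    ∃ C : ℝ, 0 < C ∧ ∀ x : ℕ, 1 ≤ x → ∀ m ≤ x, ∀ s : Finset ℕ, (∀ n ∈ s, 2 * x < n) →
      ∑ n ∈ s, tailTerm q m n ≤ C * (x : ℝ) ^ (2 - 2 * q) := by
  have hsum : Summable fun n : ℕ => (n : ℝ) ^ (-(3 / 2) : ℝ) :=
    Real.summable_nat_rpow.2 (by norm_num)
  set K := ∑' n : ℕ, (n : ℝ) ^ (-(3 / 2) : ℝ) with hK
  have hK0 : 0 ≤ K := tsum_nonneg fun n => by positivity
  refine ⟨8 * 2 ^ (2 * q) * (K + 1), by positivity, fun x hx m hm s hs => ?_⟩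
  have hx0 : (0 : ℝ) < x := by exact_mod_cast hx
  calc ∑ n ∈ s, tailTerm q m n
      ≤ ∑ n ∈ s, 8 * 2 ^ (2 * q) * (x : ℝ) ^ (2 - 2 * q) * (n : ℝ) ^ (-(3 / 2) : ℝ) := by
        refine sum_le_sum fun n hn => ?_
        have hnx := hs n hn
        have hnxR : (2 * x : ℝ) < n := by exact_mod_cast hnx
        have hn0 : (0 : ℝ) < n := by linarith
        have hgap : (n : ℝ) / 2 ≤ gap m n := by
          have hmR : (m : ℝ) ≤ x := by exact_mod_cast hm
          rw [← abs_natCast_sub_eq_gap, abs_sub_comm]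
          refine le_trans ?_ (le_abs_self _)
          linarith
        have h1 : (gap m n : ℝ) ^ (-(2 * q)) ≤ ((n : ℝ) / 2) ^ (-(2 * q)) :=
          Real.rpow_le_rpow_of_nonpos (by positivity) hgap (by linarith)
        have h2 : ((n : ℝ) / 2) ^ (-(2 * q)) = 2 ^ (2 * q) * (n : ℝ) ^ (-(2 * q)) := by
          rw [Real.div_rpow hn0.le (by norm_num), Real.rpow_neg (by norm_num : (0 : ℝ) ≤ 2),
            div_inv_eq_mul, mul_comm]
        have h3 : √(n : ℝ) * (n : ℝ) ^ (-(2 * q)) =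
            (n : ℝ) ^ (2 - 2 * q) * (n : ℝ) ^ (-(3 / 2) : ℝ) := by
          rw [Real.sqrt_eq_rpow, ← Real.rpow_add hn0, ← Real.rpow_add hn0]
          congr 1
          ring
        have h4 : (n : ℝ) ^ (2 - 2 * q) ≤ (x : ℝ) ^ (2 - 2 * q) :=
          Real.rpow_le_rpow_of_nonpos hx0 (by linarith) (by linarith)
        calc tailTerm q m n ≤ 8 * √n * (2 ^ (2 * q) * (n : ℝ) ^ (-(2 * q))) := by
              rw [tailTerm]
              refine mul_le_mul (r2_le_sqrt (by lia)) (h1.trans_eq h2) (by positivity)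
                (by positivity)
          _ = 8 * 2 ^ (2 * q) * (√n * (n : ℝ) ^ (-(2 * q))) := by ring
          _ = 8 * 2 ^ (2 * q) * ((n : ℝ) ^ (2 - 2 * q) * (n : ℝ) ^ (-(3 / 2) : ℝ)) := by rw [h3]
          _ ≤ 8 * 2 ^ (2 * q) * ((x : ℝ) ^ (2 - 2 * q) * (n : ℝ) ^ (-(3 / 2) : ℝ)) := by gcongr
          _ = _ := by ring
    _ = 8 * 2 ^ (2 * q) * (x : ℝ) ^ (2 - 2 * q) * ∑ n ∈ s, (n : ℝ) ^ (-(3 / 2) : ℝ) :=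
        (mul_sum _ _ _).symm
    _ ≤ 8 * 2 ^ (2 * q) * (x : ℝ) ^ (2 - 2 * q) * (K + 1) := by
        gcongr
        have := hsum.sum_le_tsum s fun n _ => by positivity
        linarith
    _ = _ := by ring

/-- If no sum of two squares is within `K₁` of `m`, the tail splits into three ranges. -/
lemma sum_tailTerm_le_split (q : ℝ) {m x K₁ K₂ : ℕ} (hm : m ≤ x)
    (hnear : ∀ n, 1 ≤ gap m n → gap m n ≤ K₁ → n ∉ SOS) (s : Finset ℕ) (hs : m ∉ s) :
    ∑ n ∈ s, tailTerm q m n ≤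
      ∑ n ∈ range (2 * x + 1) with gap m n ∈ Ioc K₁ K₂, tailTerm q m n +
      ∑ n ∈ range (2 * x + 1) with gap m n ∈ Ioc K₂ (2 * x), tailTerm q m n +
      ∑ n ∈ s with 2 * x < n, tailTerm q m n := by
  set M₁ : Finset ℕ := {n ∈ range (2 * x + 1) | gap m n ∈ Ioc K₁ K₂} with hM₁
  set M₂ : Finset ℕ := {n ∈ range (2 * x + 1) | gap m n ∈ Ioc K₂ (2 * x)} with hM₂
  rw [← sum_filter_add_sum_filter_not s (fun n => 2 * x < n), add_comm]
  refine add_le_add_left ?_ _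
  have h1 : ∑ n ∈ s with ¬ 2 * x < n, tailTerm q m n ≤
      ∑ n ∈ M₁ ∪ M₂, tailTerm q m n := by
    rw [← sum_filter_add_sum_filter_not (s.filter fun n => ¬ 2 * x < n) (fun n => n ∈ M₁ ∪ M₂)]
    have h2 : ∑ n ∈ (s.filter fun n => ¬ 2 * x < n) with n ∉ M₁ ∪ M₂, tailTerm q m n = 0 := by
      refine sum_eq_zero fun n hn => ?_
      simp only [mem_filter, hM₁, hM₂, mem_union, mem_range, mem_Ioc, not_or, not_and] at hn
      obtain ⟨⟨hns, hnx⟩, hn1, hn2⟩ := hn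
      have hne : n ≠ m := fun h => hs (h ▸ hns)
      have hg1 : 1 ≤ gap m n := by rw [gap]; lia
      have hg2 : gap m n ≤ 2 * x := by rw [gap]; lia
      have hg3 : gap m n ≤ K₁ := by
        by_contra hc
        have := hn1 (by lia) (by lia)
        exact hn2 (by lia) (by lia) hg2
      rw [tailTerm, r2_eq_zero_of_notMem (hnear n hg1 hg3)]
      simp
    rw [h2, add_zero]
    refine sum_le_sum_of_subset_of_nonneg ?_ fun n _ _ => tailTerm_nonneg q m n
    intro n hn
    exact (mem_filter.1 hn).2
  refine h1.trans ?_
  rw [← sum_union_inter]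
  have := sum_nonneg (s := M₁ ∩ M₂) fun n _ => tailTerm_nonneg q m n
  linarith

end TailSums

section ExceptionalSet

open Finset
open scoped Classical

/-- The tail sum `∑_{n ≠ m} r₂(n) |m - n| ^ (-2q)`. -/
def tailSum (q : ℝ) (m : ℕ) : ℝ :=
  ∑' n : {n : ℕ // n ≠ m}, (r2 (n : ℕ) : ℝ) * |(m : ℝ) - ((n : ℕ) : ℝ)| ^ (-(2 * q))

/-- The tail sum at `m` is bounded by `(log m) ^ (-q + 1/2 + δ)`. -/
def GoodTail (q δ : ℝ) (m : ℕ) : Prop :=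
  3 ≤ m ∧ tailSum q m ≤ Real.log m ^ (-q + 1 / 2 + δ)

/-- The integers that may have a sum of two squares within distance `K`. -/
def crowded (δ : ℝ) (x K : ℕ) : Finset ℕ :=
  sqDivisible δ x ∪ (Icc 1 K).biUnion fun d =>
    ((sqDivisible δ x).image (· - d) ∪ (sqDivisible δ x).image (· + d)) ∪
      (unsiftedPairs δ x d ∪ (unsiftedPairs δ x d).image (· + d))

lemma notMem_SOS_of_notMem_crowded {δ : ℝ} {x m K : ℕ} (hm : m ∈ SOS) (hKm : K < m)
    (hmx : m ≤ x) (h : m ∉ crowded δ x K) :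
    m ∈ unsifted δ x ∧ ∀ n, 1 ≤ gap m n → gap m n ≤ K → n ∉ SOS := by
  simp only [crowded, mem_union, mem_biUnion, mem_image, not_or, not_exists, not_and] at h
  obtain ⟨h1, h2⟩ := h
  have hndvd := not_dvd_of_mem_SOS hm (by lia) (by lia) h1
  refine ⟨mem_filter.2 ⟨mem_range.2 (by lia), hndvd⟩, fun n hn1 hnK hn => ?_⟩
  obtain ⟨⟨h3, h4⟩, h5, h6⟩ := h2 (gap m n) (mem_Icc.2 ⟨hn1, hnK⟩)
  have hnQ : n ∉ sqDivisible δ x := by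
    intro hnQ
    rcases le_total m n with hle | hle
    · exact h3 n hnQ (by rw [gap]; lia)
    · exact h4 n hnQ (by rw [gap]; lia)
  have hn0 : 1 ≤ n := by rw [gap] at hnK; lia
  have hn2 : n ≤ 2 * x := by rw [gap] at hnK; lia
  have hndvd' := not_dvd_of_mem_SOS hn hn0 hn2 hnQ
  rcases le_total m n with hle | hle
  · refine h5 (mem_filter.2 ⟨mem_range.2 (by lia), fun p hp => ⟨hndvd p hp, ?_⟩⟩)
    rw [show m + gap m n = n by rw [gap]; lia]
    exact hndvd' p hp
  · refine h6 n (mem_filter.2 ⟨mem_range.2 (by lia), fun p hp => ⟨hndvd' p hp, ?_⟩⟩)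
      (by rw [gap]; lia)
    rw [show n + gap m n = m by rw [gap]; lia]
    exact hndvd p hp

lemma card_crowded_le {δ : ℝ} {x K : ℕ} {B : ℝ}
    (hB : ∀ d ∈ Icc 1 K, (#(unsiftedPairs δ x d) : ℝ) ≤ B) :
    (#(crowded δ x K) : ℝ) ≤ #(sqDivisible δ x) + K * (2 * #(sqDivisible δ x) + 2 * B) := by
  have h1 : #(crowded δ x K) ≤ #(sqDivisible δ x) +
      ∑ d ∈ Icc 1 K, (2 * #(sqDivisible δ x) + 2 * #(unsiftedPairs δ x d)) := by
    refine (card_union_le _ _).trans (add_le_add_right (card_biUnion_le.trans ?_) _)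
    refine sum_le_sum fun d _ => (card_union_le _ _).trans ?_
    rw [two_mul, two_mul]
    exact add_le_add ((card_union_le _ _).trans (add_le_add card_image_le card_image_le))
      ((card_union_le _ _).trans (add_le_add le_rfl card_image_le))
  have h2 : (#(crowded δ x K) : ℝ) ≤ #(sqDivisible δ x) +
      ∑ d ∈ Icc 1 K, (2 * (#(sqDivisible δ x) : ℝ) + 2 * #(unsiftedPairs δ x d)) := by
    exact_mod_cast h1
  have h3 : ∑ d ∈ Icc 1 K, (2 * (#(sqDivisible δ x) : ℝ) + 2 * #(unsiftedPairs δ x d)) ≤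
      ∑ d ∈ Icc 1 K, (2 * (#(sqDivisible δ x) : ℝ) + 2 * B) :=
    sum_le_sum fun d hd => by linarith [hB d hd]
  rw [sum_const, Nat.card_Icc, nsmul_eq_mul, Nat.add_sub_cancel] at h3
  linarith

lemma tailSum_le_of_sum_le {q : ℝ} {m : ℕ} {T : ℝ}
    (h : ∀ s : Finset ℕ, m ∉ s → ∑ n ∈ s, tailTerm q m n ≤ T) : tailSum q m ≤ T := by
  refine Real.tsum_le_of_sum_le (fun n => by positivity) fun s => ?_
  refine le_trans (le_of_eq ?_) (h (s.map (Function.Embedding.subtype _)) ?_)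
  · rw [sum_map]
    refine sum_congr rfl fun n _ => ?_
    rw [tailTerm, abs_natCast_sub_eq_gap]
    rfl
  · simp

lemma eventually_far_le {q C e : ℝ} (hq : 1 < q) (hC : 0 < C) :
    ∀ᶠ x : ℕ in atTop, C * (x : ℝ) ^ (2 - 2 * q) ≤ Real.log x ^ e / 3 := by
  have h1 := (isLittleO_log_rpow_rpow_atTop (-e) (by linarith : 0 < 2 * q - 2)).bound
    (by positivity : 0 < 1 / (3 * C))
  filter_upwards [tendsto_natCast_atTop_atTop.eventually h1,
    tendsto_log_natCast_atTop.eventually_ge_atTop 1, eventually_ge_atTop 1] with x hx hL hx1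
  have hx0 : (0 : ℝ) < x := by exact_mod_cast hx1
  have hL0 : 0 < Real.log x := by linarith
  rw [Real.norm_of_nonneg (by positivity), Real.norm_of_nonneg (by positivity),
    Real.rpow_neg hL0.le] at hx
  rw [show 2 - 2 * q = -(2 * q - 2) by ring, Real.rpow_neg hx0.le]
  have h2 : 0 < Real.log x ^ e := by positivity
  have h3 : 0 < (x : ℝ) ^ (2 * q - 2) := by positivity
  rw [inv_eq_one_div, div_le_iff₀ h2] at hx
  rw [← div_eq_mul_inv, div_le_div_iff₀ h3 (by norm_num)]
  have h4 : 1 / (3 * C) * (x : ℝ) ^ (2 * q - 2) * Real.log x ^ e * (3 * C) =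
      Real.log x ^ e * (x : ℝ) ^ (2 * q - 2) := by field_simp
  nlinarith

set_option maxHeartbeats 1000000 in
/-- For `q > 1` and `δ₀ > 0`, very few sums of two squares have a large tail sum. -/
lemma card_not_goodTail_le {q δ₀ : ℝ} (hq : 1 < q) (hδ₀ : 0 < δ₀) (hδ₀' : δ₀ ≤ 1 / 2) :
    ∃ C η : ℝ, 0 < C ∧ 0 < η ∧ ∀ᶠ x : ℕ in atTop,
      (#{m ∈ range (x + 1) | m ∈ SOS ∧ ¬ GoodTail q δ₀ m} : ℝ) ≤
        C * x * Real.log x ^ (-(1 / 2) - η) := by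
  set η := δ₀ / (8 * q) with hη
  have hη0 : 0 < η := by positivity
  have hηq : 8 * (q * η) = δ₀ := by rw [hη]; field_simp
  have hη1 : 8 * η ≤ 1 / 2 := by nlinarith
  set e := -q + 1 / 2 + δ₀ with he
  obtain ⟨C₁, hC₁, hmid⟩ := sum_r2_shift_unsifted_le (δ := η / 2) (by positivity) (by linarith)
  obtain ⟨C₂, hC₂, hpair⟩ := card_unsifted_pairs_le (δ := η / 2) (by positivity) (by linarith)
  obtain ⟨C₃, hC₃, hfar⟩ := sum_tailTerm_far_le hq
  refine ⟨14 + 2 * C₂ + 12 * C₁ + 384, η, by positivity, hη0, ?_⟩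
  filter_upwards [hmid, hpair, eventually_far_le (e := e) hq hC₃,
    eventually_sq_log_lt_floor (half_pos hη0), eventually_sieve_parameters (half_pos hη0),
    eventually_ge_atTop 16] with x hmid hpair hfar' hexp hpar hx16
  obtain ⟨hexp, -⟩ := hexp
  obtain ⟨hL1, -, hLx⟩ := hpar
  set L := Real.log x with hL
  have hL0 : 0 < L := by linarith
  have hx0 : (0 : ℝ) < x := by exact_mod_cast (by lia : 0 < x)
  set H := L ^ (1 / 2 - 2 * η) with hH
  have hH1 : 1 ≤ H := Real.one_le_rpow hL1 (by linarith)
  have hHL : H ≤ L := by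
    calc H ≤ L ^ (1 : ℝ) := Real.rpow_le_rpow_of_exponent_le hL1 (by linarith)
      _ = L := Real.rpow_one L
  set K₁ := ⌊H⌋₊ with hK₁
  set K₂ := ⌊L ^ 2⌋₊ with hK₂
  have hK₁H : (K₁ : ℝ) ≤ H := Nat.floor_le (by linarith)
  have hK₂L : (K₂ : ℝ) ≤ L ^ 2 := Nat.floor_le (by positivity)
  have hL2x : L ^ 2 ≤ (x : ℝ) ^ (1 / 2 : ℝ) := by
    calc L ^ 2 ≤ ((x : ℝ) ^ (1 / 4 : ℝ)) ^ 2 := by gcongr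
      _ = (x : ℝ) ^ (1 / 2 : ℝ) := by
        rw [← Real.rpow_natCast, ← Real.rpow_mul hx0.le]; norm_num
  have hsx : (x : ℝ) ^ (1 / 2 : ℝ) * (x : ℝ) ^ (1 / 2 : ℝ) = x := by
    rw [← Real.rpow_add hx0]; norm_num
  have hsx1 : 1 ≤ (x : ℝ) ^ (1 / 2 : ℝ) :=
    Real.one_le_rpow (by exact_mod_cast (by lia : 1 ≤ x)) (by norm_num)
  have hK₁x : K₁ ≤ Nat.sqrt x := by
    rw [Nat.le_sqrt']
    have : (K₁ : ℝ) ^ 2 ≤ x := by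
      calc (K₁ : ℝ) ^ 2 ≤ L ^ 2 := by gcongr; linarith
        _ ≤ (x : ℝ) ^ (1 / 2 : ℝ) := hL2x
        _ ≤ (x : ℝ) ^ (1 / 2 : ℝ) * (x : ℝ) ^ (1 / 2 : ℝ) :=
          le_mul_of_one_le_right (by positivity) hsx1
        _ = x := hsx
    exact_mod_cast this
  have hs3 : 3 ≤ Nat.sqrt x := Nat.le_sqrt.2 (by lia)
  set T := L ^ e with hT
  have hT0 : 0 < T := by positivity
  set mid : ℕ → ℝ := fun m =>
    ∑ n ∈ range (2 * x + 1) with gap m n ∈ Ioc K₁ K₂, tailTerm q m n with hmiddef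
  set far : ℕ → ℝ := fun m =>
    ∑ n ∈ range (2 * x + 1) with gap m n ∈ Ioc K₂ (2 * x), tailTerm q m n with hfardef
  have hcover : ({m ∈ range (x + 1) | m ∈ SOS ∧ ¬ GoodTail q δ₀ m} : Finset ℕ) ⊆
      ((range (Nat.sqrt x + 1) ∪ crowded (η / 2) x K₁) ∪
        {m ∈ unsifted (η / 2) x | T / 3 < mid m}) ∪ {m ∈ range (x + 1) | T / 3 < far m} := by
    intro m hm
    by_contra hcon
    simp only [mem_union, mem_filter, mem_range, not_or, not_and, not_lt] at hm hcon
    obtain ⟨hmx, hmS, hbad⟩ := hm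
    obtain ⟨⟨⟨hc1, hc2⟩, hc3⟩, hc4⟩ := hcon
    obtain ⟨hun, hnear⟩ :=
      notMem_SOS_of_notMem_crowded hmS (by lia : K₁ < m) (by lia : m ≤ x) hc2
    refine hbad ⟨by lia, ?_⟩
    have hm0 : (0 : ℝ) < m := by exact_mod_cast (by lia : 0 < m)
    have hlogm : Real.log m ≤ L := Real.log_le_log hm0 (by exact_mod_cast (by lia : m ≤ x))
    have hlogm0 : 0 < Real.log m := Real.log_pos (by exact_mod_cast (by lia : 1 < m))
    have hTm : T ≤ Real.log m ^ e :=
      Real.rpow_le_rpow_of_nonpos hlogm0 hlogm (by rw [he]; linarith)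
    refine (tailSum_le_of_sum_le fun s hs => ?_).trans hTm
    have h1 := sum_tailTerm_le_split q (K₂ := K₂) (by lia : m ≤ x) hnear s hs
    have h2 := hfar x (by lia) m (by lia) (s.filter fun n => 2 * x < n)
      fun n hn => (mem_filter.1 hn).2
    have h3 : mid m ≤ T / 3 := hc3 hun
    have h4 : far m ≤ T / 3 := hc4 (by lia)
    linarith
  set β := -(1 / 2) - η with hβ
  have hpow : ∀ a : ℝ, a ≤ β → L ^ a ≤ L ^ β := fun a ha =>
    Real.rpow_le_rpow_of_exponent_le hL1 ha
  have hsmall : (#(range (Nat.sqrt x + 1)) : ℝ) ≤ 2 * x * L ^ β := by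
    have h1 : ((Nat.sqrt x : ℕ) : ℝ) ≤ (x : ℝ) ^ (1 / 2 : ℝ) := by
      rw [← Real.sqrt_eq_rpow]; exact Real.nat_sqrt_le_real_sqrt
    have h2 : (x : ℝ) ^ (1 / 2 : ℝ) ≤ x * L ^ (-2 : ℝ) := by
      rw [Real.rpow_neg hL0.le, ← div_eq_mul_inv, le_div_iff₀ (by positivity)]
      calc (x : ℝ) ^ (1 / 2 : ℝ) * L ^ (2 : ℝ) ≤ (x : ℝ) ^ (1 / 2 : ℝ) * (x : ℝ) ^ (1 / 2 : ℝ) := by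
            gcongr
            exact_mod_cast hL2x
        _ = x := hsx
    have h3 : (x : ℝ) * L ^ (-2 : ℝ) ≤ x * L ^ β :=
      mul_le_mul_of_nonneg_left (hpow _ (by rw [hβ]; linarith)) (by positivity)
    rw [card_range]
    push_cast
    linarith
  have hcrowd : (#(crowded (η / 2) x K₁) : ℝ) ≤ (12 + 2 * C₂) * x * L ^ β := by
    have h1 := card_crowded_le (δ := η / 2) (x := x) (K := K₁)
      (B := C₂ * x * L ^ (-(1 - 2 * (η / 2)))) fun d hd => by
        obtain ⟨hd1, hd2⟩ := mem_Icc.1 hd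
        refine hpair d hd1 ?_
        have : (d : ℝ) ≤ K₁ := by exact_mod_cast hd2
        nlinarith
    have hQ : (#(sqDivisible (η / 2) x) : ℝ) ≤ 4 * x * L ^ (-4 : ℝ) := by
      refine (card_sqDivisible_le _ _).trans ?_
      have : Real.exp (-L ^ (η / 2)) ≤ L ^ (-4 : ℝ) := by
        rw [Real.exp_neg, Real.rpow_neg hL0.le]
        gcongr
        exact_mod_cast hexp
      gcongr
    have h2 : (K₁ : ℝ) * (2 * #(sqDivisible (η / 2) x)) ≤ 8 * x * L ^ (-3 : ℝ) := by
      calc (K₁ : ℝ) * (2 * #(sqDivisible (η / 2) x)) ≤ L * (2 * (4 * x * L ^ (-4 : ℝ))) := by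
            gcongr
            linarith
        _ = 8 * x * L ^ (-3 : ℝ) := by
            rw [show (-3 : ℝ) = 1 + -4 by norm_num, Real.rpow_add hL0, Real.rpow_one]
            ring
    have h3 : (K₁ : ℝ) * (2 * (C₂ * x * L ^ (-(1 - 2 * (η / 2))))) ≤ 2 * C₂ * x * L ^ β := by
      calc (K₁ : ℝ) * (2 * (C₂ * x * L ^ (-(1 - 2 * (η / 2)))))
          ≤ H * (2 * (C₂ * x * L ^ (-(1 - 2 * (η / 2))))) := by gcongr
        _ = 2 * C₂ * x * (L ^ (1 / 2 - 2 * η) * L ^ (-(1 - 2 * (η / 2)))) := by rw [hH]; ring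
        _ = 2 * C₂ * x * L ^ β := by
            rw [← Real.rpow_add hL0, hβ]
            congr 2
            ring
    have h4 : 4 * (x : ℝ) * L ^ (-4 : ℝ) ≤ 4 * x * L ^ β :=
      mul_le_mul_of_nonneg_left (hpow _ (by rw [hβ]; linarith)) (by positivity)
    have h5 : 8 * (x : ℝ) * L ^ (-3 : ℝ) ≤ 8 * x * L ^ β :=
      mul_le_mul_of_nonneg_left (hpow _ (by rw [hβ]; linarith)) (by positivity)
    linarith
  have hmidcard : (#{m ∈ unsifted (η / 2) x | T / 3 < mid m} : ℝ) ≤ 12 * C₁ * x * L ^ β := by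
    set B := C₁ * x * L ^ (-(1 / 2 - η / 2)) with hB
    have h1 : ∑ m ∈ unsifted (η / 2) x, mid m ≤ 2 * B * (2 * H ^ (1 - 2 * q)) := by
      refine (sum_tailTerm_le q (unsifted (η / 2) x) (range (2 * x + 1)) (Ioc K₁ K₂)
        (B := 2 * B) fun d hd => ?_).trans ?_
      · obtain ⟨hd1, hd2⟩ := mem_Ioc.1 hd
        have hdL : (d : ℝ) ≤ L ^ 2 := le_trans (by exact_mod_cast hd2) hK₂L
        have h2 := hmid d (by lia) (by simpa using hdL)
        have h3 := hmid (-d) (by lia) (by simpa using hdL)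
        have h4 := sum_gap_eq_le (unsifted (η / 2) x) (range (2 * x + 1)) d
        rw [shiftUnsifted] at h2 h3
        linarith
      · gcongr
        exact sum_rpow_Ioc_floor_le hq hH1 K₂
    refine (card_filter_lt_le_div _ mid (fun m => sum_nonneg fun n _ => tailTerm_nonneg q m n)
      (by positivity) h1).trans ?_
    rw [div_le_iff₀ (by positivity)]
    have h5 : L ^ (-(1 / 2 - η / 2)) * H ^ (1 - 2 * q) ≤ L ^ β * T := by
      rw [hH, hT, ← Real.rpow_mul hL0.le, ← Real.rpow_add hL0, ← Real.rpow_add hL0]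
      refine Real.rpow_le_rpow_of_exponent_le hL1 ?_
      rw [hβ, he]
      nlinarith
    calc 2 * B * (2 * H ^ (1 - 2 * q))
        = 4 * C₁ * x * (L ^ (-(1 / 2 - η / 2)) * H ^ (1 - 2 * q)) := by rw [hB]; ring
      _ ≤ 4 * C₁ * x * (L ^ β * T) := by gcongr
      _ = 12 * C₁ * x * L ^ β * (T / 3) := by ring
  have hfarcard : (#{m ∈ range (x + 1) | T / 3 < far m} : ℝ) ≤ 384 * x * L ^ β := by
    have h1 : ∑ m ∈ range (x + 1), far m ≤ 64 * x * (2 * (L ^ 2) ^ (1 - 2 * q)) := by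
      refine (sum_tailTerm_le q (range (x + 1)) (range (2 * x + 1)) (Ioc K₂ (2 * x))
        (B := 64 * x) fun d hd => ?_).trans ?_
      · have h2 : ∑ n ∈ range (2 * x + 1), (r2 n : ℝ) ≤ 32 * x := by
          exact_mod_cast sum_range_r2_le x (by lia)
        have h3 : ∀ S ⊆ range (2 * x + 1), ∑ n ∈ S, (r2 n : ℝ) ≤ 32 * x := fun S hS =>
          (sum_le_sum_of_subset_of_nonneg hS fun _ _ _ => Nat.cast_nonneg _).trans h2
        refine (sum_gap_eq_le _ _ d).trans
          ((add_le_add (h3 _ (filter_subset _ _)) (h3 _ (filter_subset _ _))).trans ?_)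
        linarith
      · gcongr
        exact sum_rpow_Ioc_floor_le hq (by nlinarith) _
    refine (card_filter_lt_le_div _ far (fun m => sum_nonneg fun n _ => tailTerm_nonneg q m n)
      (by positivity) h1).trans ?_
    rw [div_le_iff₀ (by positivity)]
    have h5 : (L ^ 2) ^ (1 - 2 * q) ≤ L ^ β * T := by
      rw [hT, ← Real.rpow_natCast, ← Real.rpow_mul hL0.le, ← Real.rpow_add hL0]
      refine Real.rpow_le_rpow_of_exponent_le hL1 ?_
      rw [hβ, he]
      push_cast
      linarith
    calc 64 * x * (2 * (L ^ 2) ^ (1 - 2 * q)) = 128 * x * (L ^ 2) ^ (1 - 2 * q) := by ring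
      _ ≤ 128 * x * (L ^ β * T) := by gcongr
      _ = 384 * x * L ^ β * (T / 3) := by ring
  have htotal := (card_le_card hcover).trans ((card_union_le _ _).trans (add_le_add_left
    ((card_union_le _ _).trans (add_le_add_left (card_union_le _ _) _)) _))
  have htotal' : (#{m ∈ range (x + 1) | m ∈ SOS ∧ ¬ GoodTail q δ₀ m} : ℝ) ≤
      #(range (Nat.sqrt x + 1)) + #(crowded (η / 2) x K₁) +
        #{m ∈ unsifted (η / 2) x | T / 3 < mid m} + #{m ∈ range (x + 1) | T / 3 < far m} := by
    exact_mod_cast htotal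
  linarith

end ExceptionalSet

section FullDensity

open Finset
open scoped Classical

lemma GoodTail.mono {q δ δ' : ℝ} {m : ℕ} (hδ : δ ≤ δ') (h : GoodTail q δ m) :
    GoodTail q δ' m := by
  have hlog : 1 ≤ Real.log m := by
    rw [Real.le_log_iff_exp_le (by exact_mod_cast (by linarith [h.1] : 0 < m))]
    have h3 : (3 : ℝ) ≤ m := by exact_mod_cast h.1
    linarith [Real.exp_one_lt_three]
  exact ⟨h.1, h.2.trans (Real.rpow_le_rpow_of_exponent_le hlog (by linarith))⟩

lemma card_subtype_le_eq (A : Set ℕ) (x : ℕ) :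
    Nat.card {m // m ∈ A ∧ m ≤ x} = #{m ∈ range (x + 1) | m ∈ A} :=
  Nat.subtype_card _ fun m => by simp [and_comm]

/-- The sums of two squares with a large tail sum have relative density zero. -/
lemma eventually_card_not_goodTail_le {q δ c : ℝ} (hq : 1 < q) (hδ : 0 < δ) (hδ' : δ ≤ 1 / 2)
    (hc : 0 < c) :
    ∀ᶠ x : ℕ in atTop, (#{m ∈ range (x + 1) | m ∈ SOS ∧ ¬ GoodTail q δ m} : ℝ) ≤
      c * #{m ∈ range (x + 1) | m ∈ SOS} := by
  obtain ⟨C, η, hC, hη, hbad⟩ := card_not_goodTail_le hq hδ hδ'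
  obtain ⟨c₀, hc₀, hlow⟩ := le_countSOS
  have hlim : Tendsto (fun x : ℕ => Real.log x ^ (-η)) atTop (𝓝 0) :=
    (tendsto_rpow_neg_atTop hη).comp tendsto_log_natCast_atTop
  filter_upwards [hbad, hlow, hlim.eventually_le_const (show 0 < c * c₀ / C by positivity),
    tendsto_log_natCast_atTop.eventually_ge_atTop 1] with x h1 h2 h3 hL
  have hL0 : 0 < Real.log x := by linarith
  have hcount : countSOS x = #{m ∈ range (x + 1) | m ∈ SOS} := by
    rw [countSOS]
    congr 1
    ext m
    simp
  rw [hcount] at h2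
  have hpow : Real.log x ^ (-(1 / 2) - η) = Real.log x ^ (-η) / √(Real.log x) := by
    rw [Real.sqrt_eq_rpow, ← Real.rpow_sub hL0]
    congr 1
    ring
  rw [le_div_iff₀ hC] at h3
  calc (#{m ∈ range (x + 1) | m ∈ SOS ∧ ¬ GoodTail q δ m} : ℝ)
      ≤ C * x * Real.log x ^ (-(1 / 2) - η) := h1
    _ = Real.log x ^ (-η) * C * (x / √(Real.log x)) := by rw [hpow]; ring
    _ ≤ c * c₀ * (x / √(Real.log x)) := by gcongr
    _ = c * (c₀ * (x / √(Real.log x))) := by ring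
    _ ≤ c * #{m ∈ range (x + 1) | m ∈ SOS} := by gcongr

/-- A diagonal index: given thresholds `X j`, an index `ℓ m` growing slowly enough that
`X (ℓ m) ≤ m`. -/
lemma exists_monotone_level (X : ℕ → ℕ) :
    ∃ ℓ : ℕ → ℕ, Monotone ℓ ∧ Tendsto ℓ atTop atTop ∧ ∀ m, X 0 ≤ m → X (ℓ m) ≤ m := by
  refine ⟨fun m => Nat.findGreatest (fun j => X j ≤ m) m, fun a b hab => ?_, ?_, fun m hm => ?_⟩
  · exact Nat.findGreatest_mono (fun j hj => le_trans hj hab) hab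
  · refine tendsto_atTop.2 fun j => ?_
    filter_upwards [eventually_ge_atTop j, eventually_ge_atTop (X j)] with m h1 h2
    exact Nat.le_findGreatest h1 h2
  · exact Nat.findGreatest_spec (P := fun j => X j ≤ m) (Nat.zero_le m) hm

lemma fullDensityIn_of_card_diff_le {S : Set ℕ} (hS : S ⊆ SOS) {u : ℕ → ℝ}
    (hu : Tendsto u atTop (𝓝 0))
    (h : ∀ᶠ x : ℕ in atTop, (#{m ∈ range (x + 1) | m ∈ SOS ∧ m ∉ S} : ℝ) ≤
      u x * #{m ∈ range (x + 1) | m ∈ SOS}) : FullDensityIn S := by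
  refine ⟨hS, ?_⟩
  simp only [card_subtype_le_eq]
  have hlower : Tendsto (fun x => 1 - u x) atTop (𝓝 1) := by simpa using hu.const_sub 1
  refine tendsto_of_tendsto_of_tendsto_of_le_of_le' hlower tendsto_const_nhds ?_ ?_
  · filter_upwards [h] with x hx
    have hpos : 0 < #{m ∈ range (x + 1) | m ∈ SOS} :=
      card_pos.2 ⟨0, mem_filter.2 ⟨by simp, ⟨0, 0, by simp⟩⟩⟩
    have hcover : ({m ∈ range (x + 1) | m ∈ SOS} : Finset ℕ) ⊆
        {m ∈ range (x + 1) | m ∈ S} ∪ {m ∈ range (x + 1) | m ∈ SOS ∧ m ∉ S} := by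
      intro m
      simp only [mem_filter, mem_union]
      tauto
    have hcard : (#{m ∈ range (x + 1) | m ∈ SOS} : ℝ) ≤
        #{m ∈ range (x + 1) | m ∈ S} + #{m ∈ range (x + 1) | m ∈ SOS ∧ m ∉ S} := by
      exact_mod_cast (card_le_card hcover).trans (card_union_le _ _)
    rw [le_div_iff₀ (by exact_mod_cast hpos)]
    linarith
  · refine Eventually.of_forall fun x => div_le_one_of_le₀ ?_ (Nat.cast_nonneg _)
    exact_mod_cast card_le_card (monotone_filter_right _ fun m _ hm => hS hm)

/-- A full density set of `m` with good tails, with exponents decreasing to zero along it. -/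
lemma exists_fullDensityIn_goodTail {q : ℝ} (hq : 1 < q) :
    ∃ (S : Set ℕ) (ε : ℕ → ℝ), FullDensityIn S ∧ Tendsto ε atTop (𝓝 0) ∧
      ∀ m ∈ S, GoodTail q (ε m) m := by
  have hthreshold : ∀ j : ℕ, ∃ X : ℕ, ∀ x ≥ X,
      (#{m ∈ range (x + 1) | m ∈ SOS ∧ ¬ GoodTail q (1 / ((j : ℝ) + 2)) m} : ℝ) ≤
        1 / ((j : ℝ) + 2) * #{m ∈ range (x + 1) | m ∈ SOS} := fun j =>
    eventually_atTop.1 (eventually_card_not_goodTail_le hq (by positivity)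
      (one_div_le_one_div_of_le (by norm_num) (by linarith [j.cast_nonneg (α := ℝ)]))
      (by positivity))
  choose X hX using hthreshold
  obtain ⟨ℓ, hmono, hlim, hℓ⟩ := exists_monotone_level X
  have hε : Tendsto (fun m => 1 / ((ℓ m : ℝ) + 2)) atTop (𝓝 0) :=
    tendsto_const_nhds.div_atTop
      (tendsto_atTop_add_const_right _ 2 (tendsto_natCast_atTop_atTop.comp hlim))
  obtain ⟨S, hS⟩ : ∃ S : Set ℕ, ∀ m, m ∈ S ↔ m ∈ SOS ∧ GoodTail q (1 / ((ℓ m : ℝ) + 2)) m :=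
    ⟨{m | m ∈ SOS ∧ GoodTail q (1 / ((ℓ m : ℝ) + 2)) m}, fun _ => Iff.rfl⟩
  refine ⟨S, _, fullDensityIn_of_card_diff_le (fun m hm => ((hS m).1 hm).1) hε ?_, hε,
    fun m hm => ((hS m).1 hm).2⟩
  filter_upwards [eventually_ge_atTop (X 0)] with x hx
  refine le_trans (Nat.cast_le.2 (card_le_card fun m hm => ?_)) (hX (ℓ x) x (hℓ x hx))
  obtain ⟨hmx, hmS, hbad⟩ := mem_filter.1 hm
  refine mem_filter.2 ⟨hmx, hmS, fun hgood => hbad ((hS m).2 ⟨hmS, hgood.mono ?_⟩)⟩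
  have hle : (ℓ m : ℝ) ≤ ℓ x := by
    exact_mod_cast hmono (Nat.lt_succ_iff.1 (mem_range.1 hmx))
  gcongr

end FullDensity

/-- For `q > 1` there is a full density subset `𝒩₁ ⊆ 𝒩` on which
`∑_{n ∈ 𝒩, n ≠ m} r₂(n) |m − n|^{−2q} ≤ C (log m)^{−q + 1/2 + o(1)}`
(the summand vanishes for `n ∉ 𝒩` since then `r₂(n) = 0`). -/
theorem tail_bound_full_density (q : ℝ) (hq : 1 < q) :
    ∃ (S : Set ℕ) (C : ℝ) (ε : ℕ → ℝ), FullDensityIn S ∧ 0 < C ∧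
      Tendsto ε (atTop ⊓ 𝓟 S) (𝓝 0) ∧
      ∀ m ∈ S,
        (∑' n : {n : ℕ // n ≠ m}, (r2 (n : ℕ) : ℝ) * |(m : ℝ) - ((n : ℕ) : ℝ)| ^ (-(2 * q)))
          ≤ C * Real.log m ^ (-q + 1 / 2 + ε m) := by
  obtain ⟨S, ε, hS, hε, hgood⟩ := exists_fullDensityIn_goodTail hq
  exact ⟨S, 1, ε, hS, one_pos, hε.mono_left inf_le_left, fun m hm => by
    rw [one_mul]
    exact (hgood m hm).2⟩
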